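/- arXiv:1410.3338 — 4 statements merged into one kernel-verified Lean document; each statement's English description precedes it below -/
import Mathlib

section
/- There exists exactly one twice continuously differentiable function δ₂ : [2√3, ∞) → ℝ such that |δ₂(t)| ≤ 1/(80 t²) for all t ≥ 2√3 and δ₂''(t) − 2δ₂'(t) = δ₂(t)·(e^{−2t}h_b(t)²/(π t) − 5/(36 t²)) + e^{−2t}h_b(t)δ₂(t)²/(π t) + e^{−2t}δ₂(t)³/(3π t) − R₂(t) for all t ≥ 2√3. Moreover, this function satisfies |δ₂'(t)| ≤ 11/(1000 t²) for all t ≥ 2√3. -/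
open Real Set

/-- The quasi-solution `h_b(t) = 1 − 85085/(2239488 t³) + 385/(10368 t²) − 5/(72 t)
+ e^{−2t}/(24π t)`. -/
noncomputable def hb (t : ℝ) : ℝ :=
  1 - 85085 / (2239488 * t ^ 3) + 385 / (10368 * t ^ 2) - 5 / (72 * t)
    + Real.exp (-2 * t) / (24 * π * t)

/-- The remainder `R₂ = h_b'' − 2h_b' + 5h_b/(36t²) − e^{−2t}h_b³/(3πt)`. -/
noncomputable def R2 (t : ℝ) : ℝ :=
  deriv (deriv hb) t - 2 * deriv hb t + 5 * hb t / (36 * t ^ 2)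
    - Real.exp (-2 * t) * hb t ^ 3 / (3 * π * t)

open MeasureTheory Filter Topology

theorem hasDerivAt_integral_Ioi {f : ℝ → ℝ} (hf : Continuous f)
    (hfi : ∀ t, IntegrableOn f (Ioi t)) (t : ℝ) :
    HasDerivAt (fun x => ∫ s in Ioi x, f s) (-f t) t := by
  have h : (fun x => ∫ s in Ioi x, f s) =
      fun x => (∫ s in Ioi (0 : ℝ), f s) - ∫ s in (0 : ℝ)..x, f s := by
    funext x
    rw [eq_sub_iff_add_eq', intervalIntegral.integral_interval_add_Ioi (hfi 0) (hfi x)]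
  rw [h]
  exact (intervalIntegral.integral_hasDerivAt_right (hf.intervalIntegrable 0 t)
    (hf.stronglyMeasurableAtFilter _ _) hf.continuousAt).const_sub _

/-- The decaying solution of the forced equation `u'' - 2 u' = φ`. -/
noncomputable def decaySol (φ : ℝ → ℝ) (t : ℝ) : ℝ :=
  ∫ s in Ioi t, (1 - exp (2 * (t - s))) / 2 * φ s

/-- Minus the derivative of `decaySol φ`. -/
noncomputable def decayVel (φ : ℝ → ℝ) (t : ℝ) : ℝ :=
  ∫ s in Ioi t, exp (2 * (t - s)) * φ s

theorem integrableOn_exp_mul {φ : ℝ → ℝ} {t c : ℝ} (hφ : IntegrableOn φ (Ioi t)) :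
    IntegrableOn (fun s => exp (2 * (c - s)) * φ s) (Ioi t) := by
  refine Integrable.bdd_mul (c := exp (2 * (c - t))) hφ (by fun_prop) ?_
  refine (ae_restrict_iff' measurableSet_Ioi).2 (ae_of_all _ fun s hs => ?_)
  rw [norm_of_nonneg (exp_pos _).le]
  have : t < s := hs
  gcongr

theorem hasDerivAt_decayVel {φ : ℝ → ℝ} (hφ : Continuous φ)
    (hφi : ∀ t, IntegrableOn φ (Ioi t)) (t : ℝ) :
    HasDerivAt (decayVel φ) (2 * decayVel φ t - φ t) t := by
  have key : ∀ x, decayVel φ x = exp (2 * x) * ∫ s in Ioi x, exp (2 * (0 - s)) * φ s := by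
    intro x
    rw [decayVel, ← integral_const_mul]
    refine integral_congr_ae (ae_of_all _ fun s => ?_)
    simp only [← mul_assoc, ← exp_add]
    ring_nf
  have h1 := hasDerivAt_integral_Ioi (f := fun s => exp (2 * (0 - s)) * φ s) (by fun_prop)
    (fun t => integrableOn_exp_mul (hφi t)) t
  have h2 : HasDerivAt (fun x : ℝ => exp (2 * x)) (exp (2 * t) * 2) t := by
    simpa using ((hasDerivAt_id t).const_mul 2).exp
  have h3 := h2.mul h1
  rw [show decayVel φ = _ from funext key]
  refine h3.congr_deriv ?_
  have : exp (2 * t) * exp (2 * (0 - t)) = 1 := by rw [← exp_add]; simp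
  linear_combination (-φ t) * this

theorem decaySol_eq {φ : ℝ → ℝ} (t : ℝ) (hφ : IntegrableOn φ (Ioi t)) :
    decaySol φ t = ((∫ s in Ioi t, φ s) - decayVel φ t) / 2 := by
  rw [decaySol, decayVel, ← integral_sub hφ (integrableOn_exp_mul hφ), ← integral_div]
  refine integral_congr_ae (ae_of_all _ fun s => ?_)
  ring

theorem hasDerivAt_decaySol {φ : ℝ → ℝ} (hφ : Continuous φ)
    (hφi : ∀ t, IntegrableOn φ (Ioi t)) (t : ℝ) :
    HasDerivAt (decaySol φ) (-decayVel φ t) t := by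
  rw [show decaySol φ = _ from funext fun x => decaySol_eq x (hφi x)]
  refine (((hasDerivAt_integral_Ioi hφ hφi t).sub
    (hasDerivAt_decayVel hφ hφi t)).div_const 2).congr_deriv ?_
  ring

theorem contDiff_decaySol {φ : ℝ → ℝ} (hφ : Continuous φ)
    (hφi : ∀ t, IntegrableOn φ (Ioi t)) : ContDiff ℝ 2 (decaySol φ) := by
  have hd : deriv (decaySol φ) = fun t => -decayVel φ t :=
    funext fun t => (hasDerivAt_decaySol hφ hφi t).deriv
  have hv : deriv (decayVel φ) = fun t => 2 * decayVel φ t - φ t :=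
    funext fun t => (hasDerivAt_decayVel hφ hφi t).deriv
  have hdv : Differentiable ℝ (decayVel φ) :=
    fun t => (hasDerivAt_decayVel hφ hφi t).differentiableAt
  rw [show (2 : WithTop ℕ∞) = 1 + 1 by norm_num, contDiff_succ_iff_deriv]
  refine ⟨fun t => (hasDerivAt_decaySol hφ hφi t).differentiableAt, by simp, ?_⟩
  rw [hd]
  refine ContDiff.neg ?_
  rw [contDiff_one_iff_deriv, hv]
  exact ⟨hdv, (continuous_const.mul hdv.continuous).sub hφ⟩

theorem integrableOn_Ioi_const_div_pow (K : ℝ) (n : ℕ) {t : ℝ} (ht : 0 < t) :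
    IntegrableOn (fun s : ℝ => K / s ^ (n + 2)) (Ioi t) := by
  have h := (integrableOn_Ioi_rpow_of_lt (a := -((n + 2 : ℕ) : ℝ))
    (by push_cast; linarith [(Nat.cast_nonneg n : (0 : ℝ) ≤ n)]) ht).const_mul K
  refine IntegrableOn.congr_fun h (fun s hs => ?_) measurableSet_Ioi
  have hs0 : (0 : ℝ) < s := ht.trans hs
  simp only [rpow_neg hs0.le, rpow_natCast, div_eq_mul_inv]

theorem integral_Ioi_const_div_pow (K : ℝ) (n : ℕ) {t : ℝ} (ht : 0 < t) :
    ∫ s in Ioi t, K / s ^ (n + 2) = K / ((n + 1) * t ^ (n + 1)) := by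
  have hn : (0 : ℝ) ≤ n := Nat.cast_nonneg n
  have h := integral_Ioi_rpow_of_lt (a := -((n + 2 : ℕ) : ℝ)) (by push_cast; linarith) ht
  have h2 : ∫ s in Ioi t, K / s ^ (n + 2) = ∫ s in Ioi t, K * s ^ (-((n + 2 : ℕ) : ℝ)) := by
    refine setIntegral_congr_fun measurableSet_Ioi fun s hs => ?_
    have hs0 : (0 : ℝ) < s := ht.trans hs
    simp only [rpow_neg hs0.le, rpow_natCast, div_eq_mul_inv]
  rw [h2, integral_const_mul, h,
    show -((n + 2 : ℕ) : ℝ) + 1 = -((n + 1 : ℕ) : ℝ) by push_cast; ring,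
    rpow_neg ht.le, rpow_natCast]
  push_cast
  have : (n : ℝ) + 1 ≠ 0 := by positivity
  field_simp

theorem abs_decaySol_le {φ : ℝ → ℝ} {K t : ℝ} {n : ℕ} (ht : 0 < t)
    (hφ : ∀ s, t < s → |φ s| ≤ K / s ^ (n + 2)) :
    |decaySol φ t| ≤ K / (2 * (n + 1) * t ^ (n + 1)) := by
  have h := norm_integral_le_of_norm_le (μ := volume.restrict (Ioi t))
    (f := fun s => (1 - exp (2 * (t - s))) / 2 * φ s)
    (integrableOn_Ioi_const_div_pow (K / 2) n ht)
    ((ae_restrict_iff' measurableSet_Ioi).2 (ae_of_all _ fun s hs => by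
      have hts : t < s := hs
      have h1 : exp (2 * (t - s)) ≤ 1 := exp_le_one_iff.2 (by linarith)
      have h2 := exp_pos (2 * (t - s))
      rw [norm_mul, norm_of_nonneg (by linarith), norm_eq_abs]
      calc _ ≤ 1 / 2 * (K / s ^ (n + 2)) :=
            mul_le_mul (by linarith) (hφ s hts) (abs_nonneg _) (by norm_num)
        _ = K / 2 / s ^ (n + 2) := by ring))
  rw [integral_Ioi_const_div_pow _ _ ht, norm_eq_abs] at h
  calc |decaySol φ t| ≤ _ := h
    _ = _ := by rw [div_div, ← mul_assoc]

theorem abs_decayVel_le {φ : ℝ → ℝ} {K t : ℝ} {n : ℕ} (ht : 0 < t) (hK : 0 ≤ K)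
    (hφ : ∀ s, t < s → |φ s| ≤ K / s ^ n) :
    |decayVel φ t| ≤ K / (2 * t ^ n) := by
  have e : (fun s : ℝ => exp (2 * (t - s))) = fun s => exp (2 * t) * exp (-2 * s) := by
    funext s
    rw [← exp_add]
    ring_nf
  have hi : IntegrableOn (fun s => exp (2 * (t - s))) (Ioi t) := by
    rw [e]
    exact (integrableOn_exp_mul_Ioi (by norm_num) t).const_mul _
  have hI : ∫ s in Ioi t, exp (2 * (t - s)) = 1 / 2 := by
    rw [e, integral_const_mul, integral_exp_mul_Ioi (by norm_num)]
    have : exp (2 * t) * exp (-2 * t) = 1 := by rw [← exp_add]; simp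
    linear_combination this / 2
  have h := norm_integral_le_of_norm_le (μ := volume.restrict (Ioi t))
    (f := fun s => exp (2 * (t - s)) * φ s) (hi.mul_const (K / t ^ n))
    ((ae_restrict_iff' measurableSet_Ioi).2 (ae_of_all _ fun s hs => by
      have hts : t < s := hs
      rw [norm_mul, norm_of_nonneg (exp_pos _).le, norm_eq_abs]
      have : |φ s| ≤ K / t ^ n := (hφ s hts).trans (by gcongr)
      gcongr))
  rw [integral_mul_const, hI, norm_eq_abs] at h
  calc |decayVel φ t| ≤ _ := h
    _ = _ := by ring

theorem decaySol_sub {φ ψ : ℝ → ℝ} {t : ℝ} (hφ : IntegrableOn φ (Ioi t))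
    (hψ : IntegrableOn ψ (Ioi t)) :
    decaySol φ t - decaySol ψ t = decaySol (fun s => φ s - ψ s) t := by
  have hi : ∀ {χ : ℝ → ℝ}, IntegrableOn χ (Ioi t) →
      IntegrableOn (fun s => (1 - exp (2 * (t - s))) / 2 * χ s) (Ioi t) := fun {χ} h => by
    refine ((h.sub (integrableOn_exp_mul (c := t) h)).div_const 2).congr (ae_of_all _ fun s => ?_)
    simp only [Pi.sub_apply]
    ring
  rw [decaySol, decaySol, decaySol, ← integral_sub (hi hφ) (hi hψ)]
  refine integral_congr_ae (ae_of_all _ fun s => ?_)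
  ring

theorem eqOn_const_of_hasDerivWithinAt_zero {f : ℝ → ℝ} {a : ℝ}
    (hf : ∀ t ∈ Ici a, HasDerivWithinAt f 0 (Ici a) t) : ∀ t ∈ Ici a, f t = f a := by
  intro t ht
  refine constant_of_has_deriv_right_zero
    (fun x hx => (hf x hx.1).continuousWithinAt.mono Icc_subset_Ici_self)
    (fun x hx => (hf x hx.1).mono (Ici_subset_Ici.2 hx.1)) t ⟨ht, le_rfl⟩

/-- A solution of `d'' = 2 d'` that vanishes at infinity is identically zero. -/
theorem eq_zero_of_tendsto_zero {d d' : ℝ → ℝ} {a : ℝ}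
    (hd : ∀ t ∈ Ici a, HasDerivWithinAt d (d' t) (Ici a) t)
    (hd' : ∀ t ∈ Ici a, HasDerivWithinAt d' (2 * d' t) (Ici a) t)
    (hlim : Tendsto d atTop (𝓝 0)) : ∀ t ∈ Ici a, d t = 0 := by
  have hE : ∀ c t : ℝ, HasDerivWithinAt (fun x : ℝ => exp (c * x)) (exp (c * t) * c) (Ici a) t :=
    fun c t => by simpa using (((hasDerivAt_id t).const_mul c).exp).hasDerivWithinAt
  have h1 := eqOn_const_of_hasDerivWithinAt_zero (f := fun t => d' t * exp (-2 * t))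
    (fun t ht => ((hd' t ht).mul (hE (-2) t)).congr_deriv (by ring))
  set c := d' a * exp (-2 * a)
  have hee : ∀ t : ℝ, exp (-2 * t) * exp (2 * t) = 1 := fun t => by rw [← exp_add]; simp
  have h2 := eqOn_const_of_hasDerivWithinAt_zero (f := fun t => d t - c / 2 * exp (2 * t))
    (fun t ht => by
      refine ((hd t ht).sub ((hE 2 t).const_mul (c / 2))).congr_deriv ?_
      rw [← show _ = c from h1 t ht]
      linear_combination (-d' t) * hee t)
  set k := d a - c / 2 * exp (2 * a)
  have hexp : Tendsto (fun t : ℝ => exp (-2 * t)) atTop (𝓝 0) :=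
    tendsto_exp_atBot.comp (tendsto_id.const_mul_atTop_of_neg (by norm_num))
  have h3 : Tendsto (fun t => (d t - k) * exp (-2 * t)) atTop (𝓝 ((0 - k) * 0)) :=
    (hlim.sub_const k).mul hexp
  have hc : c / 2 = (0 - k) * 0 := by
    refine tendsto_nhds_unique (tendsto_const_nhds.congr' ?_) h3
    filter_upwards [Ici_mem_atTop a] with t ht
    rw [← show _ = k from h2 t ht]
    linear_combination (-(c / 2)) * hee t
  have hc0 : c / 2 = 0 := by simpa using hc
  have hdk : ∀ t ∈ Ici a, d t = k := fun t ht => by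
    have := h2 t ht
    simpa only [hc0, zero_mul, sub_zero] using this
  have hk : k = 0 := by
    refine tendsto_nhds_unique (tendsto_const_nhds.congr' ?_) hlim
    filter_upwards [Ici_mem_atTop a] with t ht
    exact (hdk t ht).symm
  intro t ht
  rw [hdk t ht, hk]

theorem hasDerivAt_const_div_pow (c : ℝ) (n : ℕ) {t : ℝ} (ht : t ≠ 0) :
    HasDerivAt (fun x : ℝ => c / x ^ n) (-(n * c) / t ^ (n + 1)) t := by
  refine (((hasDerivAt_pow n t).inv (pow_ne_zero n ht)).const_mul c).congr_deriv ?_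
  rcases n with _ | n
  · simp
  · simp only [Nat.add_sub_cancel]
    field_simp
    ring

theorem hasDerivAt_exp_mul_div_pow (c : ℝ) (n : ℕ) {t : ℝ} (ht : t ≠ 0) :
    HasDerivAt (fun x : ℝ => exp (-2 * x) * (c / x ^ n))
      (exp (-2 * t) * (-2 * c / t ^ n - n * c / t ^ (n + 1))) t := by
  have h : HasDerivAt (fun x : ℝ => exp (-2 * x)) (exp (-2 * t) * -2) t := by
    simpa using ((hasDerivAt_id t).const_mul (-2)).exp
  refine (h.mul (hasDerivAt_const_div_pow c n ht)).congr_deriv ?_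
  ring

/-- The derivative of `hb`. -/
noncomputable def hbDeriv (t : ℝ) : ℝ :=
  85085 / 746496 / t ^ 4 - 385 / 5184 / t ^ 3 + 5 / 72 / t ^ 2
    + exp (-2 * t) * (-2 * (1 / (24 * π)) / t ^ 1 - 1 / (24 * π) / t ^ 2)

theorem hasDerivAt_hb {t : ℝ} (ht : t ≠ 0) : HasDerivAt hb (hbDeriv t) t := by
  have h := ((((hasDerivAt_const t (1 : ℝ)).sub
    (hasDerivAt_const_div_pow (85085 / 2239488) 3 ht)).add
    (hasDerivAt_const_div_pow (385 / 10368) 2 ht)).sub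
    (hasDerivAt_const_div_pow (5 / 72) 1 ht)).add
    (hasDerivAt_exp_mul_div_pow (1 / (24 * π)) 1 ht)
  have e : ∀ x, hb x = 1 - 85085 / 2239488 / x ^ 3 + 385 / 10368 / x ^ 2 - 5 / 72 / x ^ 1
      + exp (-2 * x) * (1 / (24 * π) / x ^ 1) := fun x => by
    simp only [hb, div_eq_mul_inv, mul_inv, pow_one]
    ring
  refine (h.congr_deriv ?_).congr_of_eventuallyEq (.of_forall e)
  rw [hbDeriv]
  push_cast
  ring

theorem hasDerivAt_hbDeriv {t : ℝ} (ht : t ≠ 0) :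
    HasDerivAt hbDeriv (-(85085 / 186624) / t ^ 5 + 385 / 1728 / t ^ 4 - 5 / 36 / t ^ 3
      + exp (-2 * t) * ((4 / t + 4 / t ^ 2 + 2 / t ^ 3) / (24 * π))) t := by
  have h := ((((hasDerivAt_const_div_pow (85085 / 746496) 4 ht).sub
    (hasDerivAt_const_div_pow (385 / 5184) 3 ht)).add
    (hasDerivAt_const_div_pow (5 / 72) 2 ht)).add
    (hasDerivAt_exp_mul_div_pow (-2 * (1 / (24 * π))) 1 ht)).sub
    (hasDerivAt_exp_mul_div_pow (1 / (24 * π)) 2 ht)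
  have e : ∀ x, hbDeriv x = 85085 / 746496 / x ^ 4 - 385 / 5184 / x ^ 3 + 5 / 72 / x ^ 2
      + exp (-2 * x) * (-2 * (1 / (24 * π)) / x ^ 1)
      - exp (-2 * x) * (1 / (24 * π) / x ^ 2) := fun x => by
    rw [hbDeriv]
    ring
  refine (h.congr_deriv ?_).congr_of_eventuallyEq (.of_forall e)
  push_cast
  ring

theorem R2_eq {t : ℝ} (ht : 0 < t) :
    R2 t = -(37182145 / 80621568) / t ^ 5
      + exp (-2 * t) * ((6 / t ^ 2 + 77 / 36 / t ^ 3) / (24 * π))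
      + exp (-2 * t) * ((1 - hb t ^ 3) / (3 * π * t)) := by
  have h : deriv hb =ᶠ[𝓝 t] hbDeriv := by
    filter_upwards [Ioi_mem_nhds ht] with x hx
    exact (hasDerivAt_hb (ne_of_gt hx)).deriv
  have hlin : 5 * hb t / (36 * t ^ 2) = 5 * (1 - 85085 / (2239488 * t ^ 3) + 385 / (10368 * t ^ 2)
      - 5 / (72 * t) + exp (-2 * t) / (24 * π * t)) / (36 * t ^ 2) := by rw [hb]
  rw [R2, h.deriv_eq, (hasDerivAt_hbDeriv ht.ne').deriv, (hasDerivAt_hb ht.ne').deriv, hlin,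
    hbDeriv]
  have := pi_pos.ne'
  field_simp
  ring

theorem exp_neg_two_mul_le {t : ℝ} (ht : 0 < t) : exp (-2 * t) ≤ 3 / 2 / t ^ 4 := by
  have h := pow_div_factorial_le_exp (2 * t) (by positivity) 4
  have h4 : ((Nat.factorial 4 : ℕ) : ℝ) = 24 := by norm_num [Nat.factorial]
  rw [h4] at h
  rw [neg_mul, exp_neg, inv_le_comm₀ (exp_pos _) (by positivity)]
  refine le_trans (le_of_eq ?_) h
  field_simp
  ring

theorem exp_div_pi_mul_le {t : ℝ} (ht : 0 < t) : exp (-2 * t) / (π * t) ≤ 1 / 2 / t ^ 5 := by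
  calc exp (-2 * t) / (π * t) ≤ (3 / 2 / t ^ 4) / (3 * t) := by
        gcongr
        exacts [exp_neg_two_mul_le ht, pi_gt_three.le]
    _ = 1 / 2 / t ^ 5 := by field_simp

theorem hb_mem_Icc {t : ℝ} (ht : 17 / 5 ≤ t) : hb t ∈ Icc (0 : ℝ) 1 := by
  have h0 : 0 < t := by linarith
  have hx : 1 / t ≤ 5 / 17 := by
    rw [div_le_div_iff₀ h0 (by norm_num)]; linarith
  have hx0 : 0 < 1 / t := by positivity
  have hE : exp (-2 * t) / (π * t) ≤ 1 / 2 * (1 / t) ^ 5 := by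
    refine (exp_div_pi_mul_le h0).trans (le_of_eq ?_)
    field_simp
  have hE0 : 0 < exp (-2 * t) / (π * t) := by positivity
  have e : hb t = 1 - 85085 / 2239488 * (1 / t) ^ 3 + 385 / 10368 * (1 / t) ^ 2 - 5 / 72 * (1 / t)
      + exp (-2 * t) / (π * t) / 24 := by
    rw [hb]
    have := pi_pos.ne'
    field_simp
  rw [e]
  generalize 1 / t = x at *
  have h2 : x ^ 2 ≤ 5 / 17 * x := by nlinarith
  have h20 : 0 < x ^ 2 := by positivity
  have h3 : x ^ 3 ≤ 5 / 17 * x ^ 2 := by nlinarith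
  have h30 : 0 < x ^ 3 := by positivity
  have h5 : x ^ 5 ≤ x ^ 3 := by nlinarith
  constructor <;> linarith

theorem abs_R2_le {t : ℝ} (ht : 17 / 5 ≤ t) : |R2 t| ≤ 6 / 25 / t ^ 4 := by
  have h0 : 0 < t := by linarith
  obtain ⟨hb0, hb1⟩ := hb_mem_Icc ht
  have hc1 : hb t ^ 3 ≤ 1 := pow_le_one₀ hb0 hb1
  have hc0 : 0 ≤ hb t ^ 3 := by positivity
  have hx : 1 / t ≤ 5 / 17 := by
    rw [div_le_div_iff₀ h0 (by norm_num)]; linarith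
  have hx0 : 0 < 1 / t := by positivity
  have hE : exp (-2 * t) / (π * t) ≤ 1 / 2 * (1 / t) ^ 5 := by
    refine (exp_div_pi_mul_le h0).trans (le_of_eq ?_)
    field_simp
  have hE0 : 0 < exp (-2 * t) / (π * t) := by positivity
  have e : R2 t = -(37182145 / 80621568) * (1 / t) ^ 5
      + exp (-2 * t) / (π * t) * ((6 * (1 / t) + 77 / 36 * (1 / t) ^ 2) / 24
        + (1 - hb t ^ 3) / 3) := by
    rw [R2_eq h0]
    have := pi_pos.ne'
    field_simp
    ring
  have e2 : 6 / 25 / t ^ 4 = 6 / 25 * (1 / t) ^ 4 := by field_simp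
  rw [e, e2]
  generalize 1 / t = x at *
  generalize exp (-2 * t) / (π * t) = y at *
  have h5 : x ^ 5 ≤ 5 / 17 * x ^ 4 := by
    have : 0 < x ^ 4 := by positivity
    nlinarith
  have h50 : 0 < x ^ 5 := by positivity
  have hz : (6 * x + 77 / 36 * x ^ 2) / 24 + (1 - hb t ^ 3) / 3 ≤ 1 / 2 := by nlinarith
  have hz0 : 0 ≤ (6 * x + 77 / 36 * x ^ 2) / 24 + (1 - hb t ^ 3) / 3 := by
    have : 0 ≤ 1 - hb t ^ 3 := by linarith
    positivity
  have hm := mul_le_mul hE hz hz0 (by positivity)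
  have hm0 := mul_nonneg hE0.le hz0
  rw [abs_le]
  constructor <;> linarith

theorem continuousOn_hb : ContinuousOn hb (Ioi 0) :=
  fun _ ht => (hasDerivAt_hb (ne_of_gt ht)).continuousAt.continuousWithinAt

theorem continuousOn_R2 : ContinuousOn R2 (Ioi 0) := by
  have h : ContinuousOn (fun t => -(37182145 / 80621568) / t ^ 5
      + exp (-2 * t) * ((6 / t ^ 2 + 77 / 36 / t ^ 3) / (24 * π))
      + exp (-2 * t) * ((1 - hb t ^ 3) / (3 * π * t))) (Ioi 0) := by
    have := continuousOn_hb
    have hpi := pi_pos.ne'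
    have hn : ∀ t ∈ Ioi (0 : ℝ), t ≠ 0 := fun t ht => ne_of_gt ht
    fun_prop (disch := first | assumption | (intro x hx; have := hn x hx; positivity))
  exact h.congr fun t ht => R2_eq ht

/-- The right-hand side of the equation for `δ₂`. -/
noncomputable def forcing (t a : ℝ) : ℝ :=
  a * (exp (-2 * t) * hb t ^ 2 / (π * t) - 5 / (36 * t ^ 2))
    + exp (-2 * t) * hb t * a ^ 2 / (π * t) + exp (-2 * t) * a ^ 3 / (3 * π * t) - R2 t

theorem abs_forcing_sub_le {t a b : ℝ} (ht : 17 / 5 ≤ t) (ha : |a| ≤ 1) (hb' : |b| ≤ 1) :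
    |forcing t a - forcing t b| ≤ |a - b| / 4 / t ^ 2 := by
  have h0 : 0 < t := by linarith
  obtain ⟨hb0, hb1⟩ := hb_mem_Icc ht
  obtain ⟨ha0, ha1⟩ := abs_le.1 ha
  obtain ⟨hb0', hb1'⟩ := abs_le.1 hb'
  have e : forcing t a - forcing t b = (a - b) * (exp (-2 * t) / (π * t)
      * (hb t ^ 2 + hb t * (a + b) + (a ^ 2 + a * b + b ^ 2) / 3) - 5 / 36 / t ^ 2) := by
    rw [forcing, forcing]
    have := pi_pos.ne'
    field_simp
    ring
  have hE : exp (-2 * t) / (π * t) ≤ 1 / 78 / t ^ 2 := by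
    refine (exp_div_pi_mul_le h0).trans ?_
    rw [div_div, div_div, div_le_div_iff₀ (by positivity) (by positivity)]
    have h3 : (17 / 5 : ℝ) ^ 3 ≤ t ^ 3 := by gcongr
    have : t ^ 5 = t ^ 3 * t ^ 2 := by ring
    nlinarith [pow_pos h0 2]
  have hE0 : 0 < exp (-2 * t) / (π * t) := by positivity
  have hQ : |hb t ^ 2 + hb t * (a + b) + (a ^ 2 + a * b + b ^ 2) / 3| ≤ 4 := by
    have h1 : |hb t| ≤ 1 := abs_le.2 ⟨by linarith, hb1⟩
    have h2 : |hb t ^ 2| ≤ 1 := by rw [abs_pow]; exact pow_le_one₀ (abs_nonneg _) h1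
    have h3 : |hb t * (a + b)| ≤ 1 * 2 := by
      rw [abs_mul]
      exact mul_le_mul h1 (abs_le.2 ⟨by linarith, by linarith⟩) (abs_nonneg _) (by norm_num)
    rw [abs_le] at h2 h3 ⊢
    constructor <;> nlinarith
  have hyq : |exp (-2 * t) / (π * t)
      * (hb t ^ 2 + hb t * (a + b) + (a ^ 2 + a * b + b ^ 2) / 3)| ≤ 1 / 78 / t ^ 2 * 4 := by
    rw [abs_mul, abs_of_pos hE0]
    exact mul_le_mul hE hQ (abs_nonneg _) (by positivity)
  rw [e, abs_mul, show |a - b| / 4 / t ^ 2 = |a - b| * (1 / 4 * (1 / t ^ 2)) by ring]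
  refine mul_le_mul_of_nonneg_left ?_ (abs_nonneg _)
  have hs : 0 < 1 / t ^ 2 := by positivity
  rw [show 1 / 78 / t ^ 2 * 4 = 4 / 78 * (1 / t ^ 2) by ring, abs_le] at hyq
  rw [show 5 / 36 / t ^ 2 = 5 / 36 * (1 / t ^ 2) by ring, abs_le]
  constructor <;> linarith

theorem abs_forcing_le {t a : ℝ} (ht : 17 / 5 ≤ t) (ha : |a| ≤ 1 / (80 * t ^ 2)) :
    |forcing t a| ≤ 1 / 4 / t ^ 4 := by
  have h0 : 0 < t := by linarith
  have h1 : 1 / (80 * t ^ 2) ≤ 1 := by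
    rw [div_le_one (by positivity)]
    nlinarith
  have h := abs_forcing_sub_le ht (ha.trans h1) (b := 0) (by simp)
  have h2 : |a - 0| / 4 / t ^ 2 ≤ 1 / 320 / t ^ 4 := by
    rw [sub_zero]
    calc |a| / 4 / t ^ 2 ≤ 1 / (80 * t ^ 2) / 4 / t ^ 2 := by gcongr
      _ = 1 / 320 / t ^ 4 := by field_simp; norm_num
  have h3 : |forcing t 0| ≤ 6 / 25 / t ^ 4 := by
    simpa [forcing] using abs_R2_le ht
  calc |forcing t a| = |(forcing t a - forcing t 0) + forcing t 0| := by rw [sub_add_cancel]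
    _ ≤ 1 / 320 / t ^ 4 + 6 / 25 / t ^ 4 :=
      (abs_add_le _ _).trans (add_le_add (h.trans h2) h3)
    _ ≤ 1 / 4 / t ^ 4 := by
      rw [← add_div]
      exact div_le_div_of_nonneg_right (by norm_num) (by positivity)

theorem le_two_mul_sqrt_three : (17 / 5 : ℝ) ≤ 2 * √3 := by
  have : (17 / 10 : ℝ) ≤ √3 := le_sqrt_of_sq_le (by norm_num)
  linarith

theorem le_of_mem_Ici_two_mul_sqrt_three {t : ℝ} (ht : t ∈ Ici (2 * √3)) : 17 / 5 ≤ t :=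
  le_two_mul_sqrt_three.trans ht

/-- The forcing along `f`, extended to the left of `2√3` by a constant. -/
noncomputable def source (f : ℝ → ℝ) (s : ℝ) : ℝ :=
  forcing (max s (2 * √3)) (f (max s (2 * √3)))

theorem source_of_mem {f : ℝ → ℝ} {s : ℝ} (hs : s ∈ Ici (2 * √3)) :
    source f s = forcing s (f s) := by
  rw [source, max_eq_left hs]

theorem source_congr {f g : ℝ → ℝ} (h : EqOn f g (Ici (2 * √3))) : source f = source g := by
  funext s
  rw [source, source, h (le_max_right s _)]

theorem continuous_source {f : ℝ → ℝ} (hf : ContinuousOn f (Ici (2 * √3))) :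
    Continuous (source f) := by
  have hsub : Ici (2 * √3) ⊆ Ioi 0 := fun t ht => by
    have := le_of_mem_Ici_two_mul_sqrt_three ht
    exact mem_Ioi.2 (by linarith)
  have h : ContinuousOn (fun t => forcing t (f t)) (Ici (2 * √3)) := by
    have h1 := continuousOn_hb.mono hsub
    have h2 := continuousOn_R2.mono hsub
    have hpi := pi_pos
    unfold forcing
    fun_prop (disch := first | assumption |
      (intro x hx; have hx0 : 0 < x := hsub hx; positivity))
  exact h.comp_continuous (by fun_prop) fun s => le_max_right s _

theorem abs_source_le {f : ℝ → ℝ} (hf : ∀ t ∈ Ici (2 * √3), |f t| ≤ 1 / (80 * t ^ 2)) {s : ℝ}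
    (hs : s ∈ Ici (2 * √3)) : |source f s| ≤ 1 / 4 / s ^ (2 + 2) := by
  rw [source_of_mem hs]
  exact abs_forcing_le (le_of_mem_Ici_two_mul_sqrt_three hs) (hf s hs)

theorem integrableOn_source {f : ℝ → ℝ} (hc : ContinuousOn f (Ici (2 * √3)))
    (hf : ∀ t ∈ Ici (2 * √3), |f t| ≤ 1 / (80 * t ^ 2)) (t : ℝ) :
    IntegrableOn (source f) (Ioi t) := by
  have h0 : 0 < 2 * √3 := by positivity
  have h : IntegrableOn (source f) (Ioi (2 * √3)) := by
    refine (integrableOn_Ioi_const_div_pow (1 / 4) 2 h0).mono'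
      (continuous_source hc).aestronglyMeasurable ?_
    exact (ae_restrict_iff' measurableSet_Ioi).2
      (ae_of_all _ fun s hs => abs_source_le hf (Ioi_subset_Ici_self hs))
  refine (((continuous_source hc).integrableOn_Icc (a := t) (b := 2 * √3)).union h).mono_set
    fun s hs => ?_
  rcases le_or_gt s (2 * √3) with h' | h'
  exacts [Or.inl ⟨le_of_lt hs, h'⟩, Or.inr h']

theorem abs_decaySol_source_le {f : ℝ → ℝ} (hf : ∀ t ∈ Ici (2 * √3), |f t| ≤ 1 / (80 * t ^ 2))
    {t : ℝ} (ht : t ∈ Ici (2 * √3)) : |decaySol (source f) t| ≤ 1 / (80 * t ^ 2) := by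
  have h1 := le_of_mem_Ici_two_mul_sqrt_three ht
  have h0 : 0 < t := by linarith
  refine (abs_decaySol_le h0 fun s hs => abs_source_le hf (ht.trans hs.le)).trans ?_
  rw [div_div, div_le_div_iff₀ (by positivity) (by positivity)]
  push_cast
  nlinarith [pow_pos h0 2]

theorem abs_decayVel_source_le {f : ℝ → ℝ} (hf : ∀ t ∈ Ici (2 * √3), |f t| ≤ 1 / (80 * t ^ 2))
    {t : ℝ} (ht : t ∈ Ici (2 * √3)) : |decayVel (source f) t| ≤ 11 / (1000 * t ^ 2) := by
  have h1 := le_of_mem_Ici_two_mul_sqrt_three ht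
  have h0 : 0 < t := by linarith
  refine (abs_decayVel_le h0 (by norm_num)
    fun s hs => abs_source_le hf (ht.trans hs.le)).trans ?_
  rw [div_div, div_le_div_iff₀ (by positivity) (by positivity), pow_add]
  have : (17 / 5) ^ 2 ≤ t ^ 2 := by gcongr
  nlinarith [mul_le_mul_of_nonneg_left this (sq_nonneg t), sq_nonneg t]

theorem abs_decaySol_source_sub_le {f g : ℝ → ℝ} (hfc : ContinuousOn f (Ici (2 * √3)))
    (hf : ∀ t ∈ Ici (2 * √3), |f t| ≤ 1 / (80 * t ^ 2)) (hgc : ContinuousOn g (Ici (2 * √3)))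
    (hg : ∀ t ∈ Ici (2 * √3), |g t| ≤ 1 / (80 * t ^ 2)) {D : ℝ}
    (hD : ∀ t ∈ Ici (2 * √3), |f t - g t| ≤ D) {t : ℝ} (ht : t ∈ Ici (2 * √3)) :
    |decaySol (source f) t - decaySol (source g) t| ≤ 1 / 2 * D := by
  have h1 := le_of_mem_Ici_two_mul_sqrt_three ht
  have h0 : 0 < t := by linarith
  have hD0 : 0 ≤ D := (abs_nonneg _).trans (hD t ht)
  rw [decaySol_sub (integrableOn_source hfc hf t) (integrableOn_source hgc hg t)]
  refine (abs_decaySol_le (K := D / 4) (n := 0) h0 fun s hs => ?_).trans ?_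
  · have hs' : s ∈ Ici (2 * √3) := ht.trans hs.le
    have h2 := le_of_mem_Ici_two_mul_sqrt_three hs'
    have h3 : 1 / (80 * s ^ 2) ≤ 1 := by
      rw [div_le_one (by positivity)]
      nlinarith
    rw [source_of_mem hs', source_of_mem hs']
    refine (abs_forcing_sub_le h2 ((hf s hs').trans h3) ((hg s hs').trans h3)).trans ?_
    rw [zero_add]
    gcongr
    exact hD s hs'
  · rw [div_div, div_le_iff₀ (by positivity)]
    push_cast
    nlinarith

open scoped BoundedContinuousFunction

/-- Bounded continuous functions obeying the a priori bound on `[2√3, ∞)`. -/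
def apriori : Set (ℝ →ᵇ ℝ) := {f | ∀ t ∈ Ici (2 * √3), |f t| ≤ 1 / (80 * t ^ 2)}

theorem isClosed_apriori : IsClosed apriori := by
  simp only [apriori, ofPred_forall]
  refine isClosed_iInter fun t => isClosed_iInter fun _ => isClosed_le ?_ continuous_const
  exact (continuous_eval_const t).abs

/-- The extension of `f` from `[2√3, ∞)` by a constant, as an element of `apriori`. -/
noncomputable def toApriori (f : ℝ → ℝ) (hc : ContinuousOn f (Ici (2 * √3)))
    (hf : ∀ t ∈ Ici (2 * √3), |f t| ≤ 1 / (80 * t ^ 2)) : apriori :=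
  ⟨BoundedContinuousFunction.ofNormedAddCommGroup (fun t => f (max t (2 * √3)))
    (hc.comp_continuous (by fun_prop) fun s => le_max_right s _) 1
    fun t => by
      have ht : max t (2 * √3) ∈ Ici (2 * √3) := le_max_right t _
      have h := le_of_mem_Ici_two_mul_sqrt_three ht
      refine (hf _ ht).trans ?_
      rw [div_le_one (by positivity)]
      nlinarith,
    fun t ht => by
      simpa [max_eq_left (mem_Ici.1 ht)] using hf t ht⟩

theorem toApriori_apply {f : ℝ → ℝ} (hc : ContinuousOn f (Ici (2 * √3)))
    (hf : ∀ t ∈ Ici (2 * √3), |f t| ≤ 1 / (80 * t ^ 2)) (t : ℝ) :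
    (toApriori f hc hf).1 t = f (max t (2 * √3)) := rfl

theorem continuous_decaySol_source {f : ℝ → ℝ} (hc : ContinuousOn f (Ici (2 * √3)))
    (hf : ∀ t ∈ Ici (2 * √3), |f t| ≤ 1 / (80 * t ^ 2)) : Continuous (decaySol (source f)) :=
  (contDiff_decaySol (continuous_source hc) (integrableOn_source hc hf)).continuous

/-- The integral operator whose fixed point solves the equation for `δ₂`. -/
noncomputable def integralOp (f : apriori) : apriori :=
  toApriori (decaySol (source f.1))
    (continuous_decaySol_source f.1.continuous.continuousOn f.2).continuousOn
    fun _ ht => abs_decaySol_source_le f.2 ht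

theorem contractingWith_integralOp : ContractingWith (1 / 2) integralOp := by
  refine ⟨by rw [← NNReal.coe_lt_coe]; norm_num, LipschitzWith.of_dist_le_mul fun f g => ?_⟩
  rw [Subtype.dist_eq, Subtype.dist_eq]
  refine (BoundedContinuousFunction.dist_le (by positivity)).2 fun t => ?_
  rw [dist_eq]
  exact abs_decaySol_source_sub_le f.1.continuous.continuousOn f.2 g.1.continuous.continuousOn g.2
    (fun s _ => by rw [← dist_eq]; exact BoundedContinuousFunction.dist_coe_le_dist s)
    (le_max_right t _)

theorem eqOn_decaySol_source {g : ℝ → ℝ} (hg : ContDiffOn ℝ 2 g (Ici (2 * √3)))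
    (hgb : ∀ t ∈ Ici (2 * √3), |g t| ≤ 1 / (80 * t ^ 2))
    (hgeq : ∀ t ∈ Ici (2 * √3),
      derivWithin (derivWithin g (Ici (2 * √3))) (Ici (2 * √3)) t
        - 2 * derivWithin g (Ici (2 * √3)) t = forcing t (g t)) :
    EqOn g (decaySol (source g)) (Ici (2 * √3)) := by
  have hc := continuous_source hg.continuousOn
  have hi := integrableOn_source hg.continuousOn hgb
  have hd1 : DifferentiableOn ℝ g (Ici (2 * √3)) := hg.differentiableOn (by norm_num)
  have hd2 : DifferentiableOn ℝ (derivWithin g (Ici (2 * √3))) (Ici (2 * √3)) :=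
    (hg.derivWithin (m := 1) (uniqueDiffOn_Ici _) (by norm_num)).differentiableOn (by norm_num)
  have h := eq_zero_of_tendsto_zero (a := 2 * √3) (d := fun t => g t - decaySol (source g) t)
    (d' := fun t => derivWithin g (Ici (2 * √3)) t + decayVel (source g) t)
    (fun t ht => ((hd1 t ht).hasDerivWithinAt.sub
      (hasDerivAt_decaySol hc hi t).hasDerivWithinAt).congr_deriv (by ring))
    (fun t ht => ((hd2 t ht).hasDerivWithinAt.add
      (hasDerivAt_decayVel hc hi t).hasDerivWithinAt).congr_deriv (by
        rw [source_of_mem ht]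
        linear_combination hgeq t ht))
    (by
      refine squeeze_zero_norm' (a := fun t : ℝ => 1 / 40 * (t ^ 2)⁻¹) ?_ ?_
      · filter_upwards [Ici_mem_atTop (2 * √3)] with t ht
        calc ‖g t - decaySol (source g) t‖ ≤ 1 / (80 * t ^ 2) + 1 / (80 * t ^ 2) :=
              (norm_sub_le _ _).trans (add_le_add (hgb t ht) (abs_decaySol_source_le hgb ht))
          _ = 1 / 40 * (t ^ 2)⁻¹ := by rw [one_div, mul_inv]; ring
      · rw [← mul_zero (1 / 40 : ℝ)]
        exact (tendsto_pow_atTop two_ne_zero).inv_tendsto_atTop.const_mul _)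
  exact fun t ht => sub_eq_zero.1 (h t ht)

/-- There is exactly one twice continuously differentiable `δ₂` on `[2√3, ∞)` with
`|δ₂(t)| ≤ 1/(80t²)` solving
`δ₂'' − 2δ₂' = δ₂(e^{−2t}h_b²/(πt) − 5/(36t²)) + e^{−2t}h_bδ₂²/(πt) + e^{−2t}δ₂³/(3πt) − R₂`;
moreover it satisfies `|δ₂'(t)| ≤ 11/(1000t²)`. -/
theorem existsUnique_delta2 :
    ∃ δ₂ : ℝ → ℝ,
      (ContDiffOn ℝ 2 δ₂ (Ici (2 * Real.sqrt 3)) ∧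
        (∀ t ∈ Ici (2 * Real.sqrt 3), |δ₂ t| ≤ 1 / (80 * t ^ 2)) ∧
        (∀ t ∈ Ici (2 * Real.sqrt 3),
          derivWithin (derivWithin δ₂ (Ici (2 * Real.sqrt 3))) (Ici (2 * Real.sqrt 3)) t
              - 2 * derivWithin δ₂ (Ici (2 * Real.sqrt 3)) t =
            δ₂ t * (Real.exp (-2 * t) * hb t ^ 2 / (π * t) - 5 / (36 * t ^ 2))
              + Real.exp (-2 * t) * hb t * δ₂ t ^ 2 / (π * t)
              + Real.exp (-2 * t) * δ₂ t ^ 3 / (3 * π * t)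
              - R2 t)) ∧
      (∀ g : ℝ → ℝ,
        (ContDiffOn ℝ 2 g (Ici (2 * Real.sqrt 3)) ∧
          (∀ t ∈ Ici (2 * Real.sqrt 3), |g t| ≤ 1 / (80 * t ^ 2)) ∧
          (∀ t ∈ Ici (2 * Real.sqrt 3),
            derivWithin (derivWithin g (Ici (2 * Real.sqrt 3))) (Ici (2 * Real.sqrt 3)) t
                - 2 * derivWithin g (Ici (2 * Real.sqrt 3)) t =
              g t * (Real.exp (-2 * t) * hb t ^ 2 / (π * t) - 5 / (36 * t ^ 2))
                + Real.exp (-2 * t) * hb t * g t ^ 2 / (π * t)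
                + Real.exp (-2 * t) * g t ^ 3 / (3 * π * t)
                - R2 t)) →
        Set.EqOn g δ₂ (Ici (2 * Real.sqrt 3))) ∧
      (∀ t ∈ Ici (2 * Real.sqrt 3),
        |derivWithin δ₂ (Ici (2 * Real.sqrt 3)) t| ≤ 11 / (1000 * t ^ 2)) := by
  have : CompleteSpace apriori := isClosed_apriori.completeSpace_coe
  have : Nonempty apriori := ⟨⟨0, fun t _ => by simp; positivity⟩⟩
  set f := contractingWith_integralOp.fixedPoint with hfdef
  have hfix : integralOp f = f := contractingWith_integralOp.fixedPoint_isFixedPt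
  have hff : EqOn f.1 (decaySol (source f.1)) (Ici (2 * √3)) := fun t ht => by
    conv_lhs => rw [← hfix]
    rw [integralOp, toApriori_apply, max_eq_left ht]
  have hc := continuous_source (f := f.1) f.1.continuous.continuousOn
  have hi := integrableOn_source (f := f.1) f.1.continuous.continuousOn f.2
  have hd1 : ∀ t ∈ Ici (2 * √3), derivWithin (decaySol (source f.1)) (Ici (2 * √3)) t =
      -decayVel (source f.1) t := fun t ht =>
    (hasDerivAt_decaySol hc hi t).hasDerivWithinAt.derivWithin (uniqueDiffOn_Ici _ t ht)
  refine ⟨decaySol (source f.1), ⟨(contDiff_decaySol hc hi).contDiffOn,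
    fun t ht => abs_decaySol_source_le f.2 ht, fun t ht => ?_⟩, ?_, fun t ht => ?_⟩
  · rw [derivWithin_congr hd1 (hd1 t ht), hd1 t ht,
      (hasDerivAt_decayVel hc hi t).fun_neg.hasDerivWithinAt.derivWithin (uniqueDiffOn_Ici _ t ht),
      source_of_mem ht, hff ht, forcing]
    ring
  · rintro g ⟨hg, hgb, hgeq⟩
    have hgs := eqOn_decaySol_source hg hgb hgeq
    have hsrc : source (toApriori g hg.continuousOn hgb).1 = source g :=
      source_congr fun t ht => by rw [toApriori_apply, max_eq_left ht]
    have hgfix : integralOp (toApriori g hg.continuousOn hgb) = toApriori g hg.continuousOn hgb :=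
      Subtype.ext <| BoundedContinuousFunction.ext fun t => by
        rw [integralOp, toApriori_apply, toApriori_apply, hsrc, hgs (le_max_right t _)]
    have hgf := contractingWith_integralOp.fixedPoint_unique hgfix
    rw [← hfdef] at hgf
    rw [← hgf, hsrc]
    exact hgs
  · rw [hd1 t ht, abs_neg]
    exact abs_decayVel_source_le f.2 ht
end

section
/- Let y : [3, ∞) → ℝ be twice continuously differentiable with y''(x) = 2y(x)³ + x·y(x) for all x ≥ 3, and suppose 2√π · x^{1/4} · e^{(2/3) x^{3/2}} · y(x) → 1 as x → +∞ (i.e., y is the restriction of the Hastings–McLeod solution of the Painlevé II equation). Then |y(3) − 4/607| < 8·10⁻⁶ and |y'(3) + 64/5375| < 24·10⁻⁶. -/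
open Real Set Filter

/-- If `f` is continuous on `[a, ∞)`, eventually positive, and positivity on `(x, ∞)` always
forces positivity at `x`, then `f` is positive on `[a, ∞)`. -/
lemma pos_of_backward_induction {f : ℝ → ℝ} {a : ℝ} (hf : ContinuousOn f (Ici a))
    (hev : ∀ᶠ x in atTop, 0 < f x)
    (hstep : ∀ x ∈ Ici a, (∀ z ∈ Ioi x, 0 < f z) → 0 < f x) :
    ∀ x ∈ Ici a, 0 < f x := by
  obtain ⟨N, hN⟩ := eventually_atTop.1 hev
  by_contra! hcon
  obtain ⟨x₁, hx₁, hfx₁⟩ := hcon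
  have hclosed : IsClosed (Ici a ∩ f ⁻¹' Iic 0) :=
    hf.preimage_isClosed_of_isClosed isClosed_Ici isClosed_Iic
  have hbdd : BddAbove (Ici a ∩ f ⁻¹' Iic 0) := by
    refine ⟨N, fun x hx => ?_⟩
    by_contra! hlt
    exact absurd (hN x hlt.le) (not_lt.2 hx.2)
  have hmem := hclosed.csSup_mem ⟨x₁, hx₁, hfx₁⟩ hbdd
  refine absurd (hstep _ hmem.1 fun z hz => ?_) (not_lt.2 hmem.2)
  by_contra! hle
  exact absurd (le_csSup hbdd ⟨(hmem.1.trans (le_of_lt hz) : a ≤ z), hle⟩) (not_le.2 hz)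

/-- Sturm-type comparison from infinity: if the Wronskian `y'F - yF'` is nondecreasing and
`y / F → C`, where `F` is positive and bounded, then the Wronskian is nonpositive and
`C F ≤ y`. -/
lemma sturm_comparison_atTop {y y₁ y₂ F F₁ F₂ : ℝ → ℝ} {a C M : ℝ}
    (hyc : ContinuousOn y (Ici a)) (hy₁c : ContinuousOn y₁ (Ici a))
    (hFc : ContinuousOn F (Ici a)) (hF₁c : ContinuousOn F₁ (Ici a))
    (hy : ∀ x ∈ Ioi a, HasDerivAt y (y₁ x) x) (hy₁ : ∀ x ∈ Ioi a, HasDerivAt y₁ (y₂ x) x)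
    (hF : ∀ x ∈ Ioi a, HasDerivAt F (F₁ x) x) (hF₁ : ∀ x ∈ Ioi a, HasDerivAt F₁ (F₂ x) x)
    (hpos : ∀ x ∈ Ici a, 0 < F x) (hM : ∀ x ∈ Ici a, F x ≤ M)
    (hW : ∀ x ∈ Ioi a, y x * F₂ x ≤ y₂ x * F x)
    (hlim : Tendsto (fun x => y x / F x) atTop (nhds C)) :
    y₁ a * F a ≤ y a * F₁ a ∧ C * F a ≤ y a := by
  have hWmono : MonotoneOn (fun x => y₁ x * F x - y x * F₁ x) (Ici a) := by
    have hd : ∀ x ∈ Ioi a, HasDerivAt (fun x => y₁ x * F x - y x * F₁ x)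
        (y₂ x * F x - y x * F₂ x) x := fun x hx => by
      have := ((hy₁ x hx).mul (hF x hx)).sub ((hy x hx).mul (hF₁ x hx))
      exact this.congr_deriv (by ring)
    refine monotoneOn_of_deriv_nonneg (convex_Ici a)
      ((hy₁c.mul hFc).sub (hyc.mul hF₁c)) ?_ ?_
    · rw [interior_Ici]
      exact fun x hx => (hd x hx).differentiableAt.differentiableWithinAt
    · rw [interior_Ici]
      intro x hx
      rw [(hd x hx).deriv]
      linarith [hW x hx]
  have hq : ∀ x ∈ Ioi a, HasDerivAt (fun x => y x / F x)
      ((y₁ x * F x - y x * F₁ x) / F x ^ 2) x := fun x hx =>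
    (hy x hx).div (hF x hx) (hpos x (Ioi_subset_Ici_self hx)).ne'
  have hqc : ContinuousOn (fun x => y x / F x) (Ici a) :=
    hyc.div hFc fun x hx => (hpos x hx).ne'
  have hWnonpos : ∀ x ∈ Ici a, y₁ x * F x - y x * F₁ x ≤ 0 := by
    intro x₁ hx₁
    replace hx₁ : a ≤ x₁ := hx₁
    by_contra! hcon
    set w := y₁ x₁ * F x₁ - y x₁ * F₁ x₁ with hw
    have hMpos : 0 < M := (hpos x₁ hx₁).trans_le (hM x₁ hx₁)
    have hgrow : ∀ x ∈ Ici x₁, w / M ^ 2 * (x - x₁) ≤ y x / F x - y x₁ / F x₁ := by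
      intro x hx
      refine (convex_Ici x₁).mul_sub_le_image_sub_of_le_deriv
        (f := fun x => y x / F x) (hqc.mono (Ici_subset_Ici.2 hx₁)) ?_ ?_ x₁ self_mem_Ici x hx hx
      · rw [interior_Ici]
        exact fun z (hz : x₁ < z) =>
          (hq z (mem_Ioi.2 (hx₁.trans_lt hz))).differentiableAt.differentiableWithinAt
      · rw [interior_Ici]
        intro z (hz : x₁ < z)
        have hza : z ∈ Ioi a := mem_Ioi.2 (hx₁.trans_lt hz)
        rw [(hq z hza).deriv]
        have hwz : w ≤ y₁ z * F z - y z * F₁ z :=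
          hWmono hx₁ (Ioi_subset_Ici_self hza) hz.le
        have hFz := hpos z (Ioi_subset_Ici_self hza)
        have hMz := hM z (Ioi_subset_Ici_self hza)
        gcongr
        exact hcon.le.trans hwz
    have htop : Tendsto (fun x => y x / F x) atTop atTop := by
      have h1 : Tendsto (fun x => w / M ^ 2 * (x - x₁) + y x₁ / F x₁) atTop atTop :=
        tendsto_atTop_add_const_right _ _
          ((tendsto_atTop_add_const_right _ (-x₁) tendsto_id).const_mul_atTop (by positivity))
      refine tendsto_atTop_mono' _ ?_ h1
      filter_upwards [eventually_ge_atTop x₁] with x hx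
      linarith [hgrow x hx]
    exact not_tendsto_nhds_of_tendsto_atTop htop C hlim
  have hanti : AntitoneOn (fun x => y x / F x) (Ici a) := by
    refine antitoneOn_of_deriv_nonpos (convex_Ici a) hqc ?_ ?_
    · rw [interior_Ici]
      exact fun x hx => (hq x hx).differentiableAt.differentiableWithinAt
    · rw [interior_Ici]
      intro x hx
      rw [(hq x hx).deriv]
      exact div_nonpos_of_nonpos_of_nonneg (hWnonpos x (Ioi_subset_Ici_self hx)) (sq_nonneg _)
  refine ⟨by linarith [hWnonpos a self_mem_Ici], ?_⟩
  rw [← le_div_iff₀ (hpos a self_mem_Ici)]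
  refine le_of_tendsto hlim ?_
  filter_upwards [eventually_ge_atTop a] with x hx
  exact hanti self_mem_Ici hx hx

/-- The leading Airy asymptotic factor `x ^ (-1/4) * exp (-(2/3) * x ^ (3/2))` as a function of
`s = √x`. -/
noncomputable def airyPrefactor (s : ℝ) : ℝ := exp (-(2 / 3) * s ^ 3 - log s / 2)

/-- A truncated Airy expansion as a function of `s = √x`. -/
noncomputable def airyExpansion (a b c s : ℝ) : ℝ :=
  airyPrefactor s * (1 + a * s⁻¹ ^ 3 + b * s⁻¹ ^ 6 + c * s⁻¹ ^ 9)

/-- The `x`-derivative of `airyExpansion a b c √x`, as a function of `s = √x`. -/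
noncomputable def airyExpansionDeriv (a b c s : ℝ) : ℝ :=
  airyPrefactor s * (-s - (1 / 4 + a) * s⁻¹ ^ 2 - (7 / 4 * a + b) * s⁻¹ ^ 5
    - (13 / 4 * b + c) * s⁻¹ ^ 8 - 19 / 4 * c * s⁻¹ ^ 11)

/-- The residual of `airyExpansion a b c √x` in the Airy equation, divided by the prefactor. -/
noncomputable def airyResidual (a b c s : ℝ) : ℝ :=
  (3 * a + 5 / 16) * s⁻¹ ^ 4 + (6 * b + 77 / 16 * a) * s⁻¹ ^ 7
    + (9 * c + 221 / 16 * b) * s⁻¹ ^ 10 + 437 / 16 * c * s⁻¹ ^ 13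

lemma hasDerivAt_airyPrefactor {s : ℝ} (hs : 0 < s) :
    HasDerivAt airyPrefactor (airyPrefactor s * (-2 * s ^ 2 - s⁻¹ / 2)) s := by
  have h := (((hasDerivAt_pow 3 s).const_mul (-(2 / 3 : ℝ))).fun_sub
    ((hasDerivAt_log hs.ne').div_const 2)).exp
  refine h.congr_deriv ?_
  simp only [airyPrefactor]
  push_cast
  ring

lemma hasDerivAt_inv_pow {s : ℝ} (hs : 0 < s) (n : ℕ) :
    HasDerivAt (fun s : ℝ => s⁻¹ ^ n) (-(n : ℝ) * s⁻¹ ^ (n + 1)) s := by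
  refine ((hasDerivAt_inv hs.ne').fun_pow n).congr_deriv ?_
  rcases n with _ | n
  · simp
  · rw [Nat.add_sub_cancel, ← inv_pow]
    ring

lemma hasDerivAt_airyExpansion {x : ℝ} (hx : 0 < x) (a b c : ℝ) :
    HasDerivAt (fun x => airyExpansion a b c √x) (airyExpansionDeriv a b c √x) x := by
  have hs : 0 < √x := sqrt_pos.2 hx
  have h := ((hasDerivAt_airyPrefactor hs).mul
    (((((hasDerivAt_inv_pow hs 3).const_mul a).const_add 1).add
      ((hasDerivAt_inv_pow hs 6).const_mul b)).add
      ((hasDerivAt_inv_pow hs 9).const_mul c))).comp x (hasDerivAt_sqrt hx.ne')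
  refine h.congr_deriv ?_
  simp only [airyExpansionDeriv, Pi.add_apply, inv_pow]
  push_cast
  field_simp
  ring

lemma hasDerivAt_airyExpansionDeriv {x : ℝ} (hx : 0 < x) (a b c : ℝ) :
    HasDerivAt (fun x => airyExpansionDeriv a b c √x)
      (x * airyExpansion a b c √x + airyPrefactor √x * airyResidual a b c √x) x := by
  have hs : 0 < √x := sqrt_pos.2 hx
  have h := ((hasDerivAt_airyPrefactor hs).mul
    ((((((hasDerivAt_id √x).neg).sub
      ((hasDerivAt_inv_pow hs 2).const_mul (1 / 4 + a))).sub
      ((hasDerivAt_inv_pow hs 5).const_mul (7 / 4 * a + b))).sub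
      ((hasDerivAt_inv_pow hs 8).const_mul (13 / 4 * b + c))).sub
      ((hasDerivAt_inv_pow hs 11).const_mul (19 / 4 * c)))).comp x (hasDerivAt_sqrt hx.ne')
  refine h.congr_deriv ?_
  rw [show x * airyExpansion a b c √x = √x ^ 2 * airyExpansion a b c √x by rw [sq_sqrt hx.le]]
  simp only [airyExpansion, airyResidual, Pi.sub_apply, Pi.neg_apply, id, inv_pow]
  push_cast
  field_simp
  ring

lemma airyPrefactor_pos (s : ℝ) : 0 < airyPrefactor s := exp_pos _

lemma airyPrefactor_le_one {s : ℝ} (hs : 1 ≤ s) : airyPrefactor s ≤ 1 := by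
  rw [airyPrefactor, exp_le_one_iff]
  have := log_nonneg hs
  have : 0 ≤ s ^ 3 := by positivity
  linarith

lemma airyPrefactor_sq {s : ℝ} (hs : 0 < s) :
    airyPrefactor s ^ 2 = exp (-(4 / 3) * s ^ 3) / s := by
  rw [airyPrefactor, ← exp_nat_mul]
  conv_rhs => rw [← exp_log hs, ← exp_sub, exp_log hs]
  congr 1
  push_cast
  ring

lemma inv_airyPrefactor_sqrt {x : ℝ} (hx : 0 < x) :
    (airyPrefactor √x)⁻¹ = x ^ ((1 : ℝ) / 4) * exp ((2 / 3) * x ^ ((3 : ℝ) / 2)) := by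
  have h3 : √x ^ 3 = x ^ ((3 : ℝ) / 2) := by
    rw [sqrt_eq_rpow, ← rpow_natCast, ← rpow_mul hx.le]
    norm_num
  rw [airyPrefactor, ← exp_neg, log_sqrt hx.le, h3, rpow_def_of_pos hx (1 / 4), ← exp_add]
  congr 1
  ring

lemma sqrt_inv_cube_le {x : ℝ} (hx : 3 ≤ x) : (√x)⁻¹ ^ 3 ≤ 1 / 5 := by
  have hs : 1.72 ≤ √x := le_sqrt_of_sq_le (by norm_num; linarith)
  rw [inv_pow, one_div]
  refine inv_anti₀ (by norm_num) ?_
  calc (5 : ℝ) ≤ 1.72 ^ 3 := by norm_num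
    _ ≤ √x ^ 3 := by gcongr

lemma tendsto_div_airyExpansion {y : ℝ → ℝ} {C : ℝ}
    (h : Tendsto (fun x => y x / airyPrefactor √x) atTop (nhds C)) (a b c : ℝ) :
    Tendsto (fun x => y x / airyExpansion a b c √x) atTop (nhds C) := by
  have hr : Tendsto (fun x : ℝ => (√x)⁻¹) atTop (nhds 0) :=
    tendsto_inv_atTop_zero.comp tendsto_sqrt_atTop
  have hP : Tendsto (fun x : ℝ => 1 + a * (√x)⁻¹ ^ 3 + b * (√x)⁻¹ ^ 6 + c * (√x)⁻¹ ^ 9)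
      atTop (nhds 1) := by
    have := (((hr.pow 3).const_mul a).const_add 1).add ((hr.pow 6).const_mul b)
      |>.add ((hr.pow 9).const_mul c)
    simpa using this
  have := h.div hP one_ne_zero
  rw [div_one] at this
  simpa only [Pi.div_def, div_div, airyExpansion] using this

lemma airyExpansion_bounds {x c : ℝ} (hx : 3 ≤ x) (hc : -1 / 6 ≤ c) (hc0 : c ≤ 0) :
    0 < airyExpansion (-5 / 48) (385 / 4608) c √x ∧
      airyExpansion (-5 / 48) (385 / 4608) c √x ≤ airyPrefactor √x := by
  suffices 0 < 1 + -5 / 48 * (√x)⁻¹ ^ 3 + 385 / 4608 * (√x)⁻¹ ^ 6 + c * (√x)⁻¹ ^ 9 ∧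
      1 + -5 / 48 * (√x)⁻¹ ^ 3 + 385 / 4608 * (√x)⁻¹ ^ 6 + c * (√x)⁻¹ ^ 9 ≤ 1 from
    ⟨mul_pos (airyPrefactor_pos _) this.1,
      mul_le_of_le_one_right (airyPrefactor_pos _).le this.2⟩
  have hz := sqrt_inv_cube_le hx
  have hz0 : 0 < (√x)⁻¹ ^ 3 := by have := sqrt_pos.2 (show 0 < x by linarith); positivity
  rw [show (√x)⁻¹ ^ 6 = ((√x)⁻¹ ^ 3) ^ 2 by ring, show (√x)⁻¹ ^ 9 = ((√x)⁻¹ ^ 3) ^ 3 by ring]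
  generalize (√x)⁻¹ ^ 3 = z at hz hz0
  have h3 : z ^ 3 ≤ 1 / 125 := by
    calc z ^ 3 ≤ (1 / 5) ^ 3 := by gcongr
      _ = _ := by norm_num
  have hcz : c * z ^ 3 ≤ 0 := mul_nonpos_of_nonpos_of_nonneg hc0 (by positivity)
  have hcz' : -1 / 6 * z ^ 3 ≤ c * z ^ 3 := by gcongr
  constructor <;> nlinarith [sq_nonneg z]

/-- A positive solution `y ∼ C x^(-1/4) exp (-(2/3) x^(3/2))` of `y'' = 2y³ + xy` stays above
`C` times an Airy subsolution, with a smaller logarithmic derivative. -/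
lemma airyExpansion_le_painleveII {y y₁ : ℝ → ℝ} {x₀ C : ℝ} (hx₀ : 3 ≤ x₀)
    (hyc : ContinuousOn y (Ici x₀)) (hy₁c : ContinuousOn y₁ (Ici x₀))
    (hy : ∀ x ∈ Ioi x₀, HasDerivAt y (y₁ x) x)
    (hy₁ : ∀ x ∈ Ioi x₀, HasDerivAt y₁ (2 * y x ^ 3 + x * y x) x)
    (hlim : Tendsto (fun x => y x / airyPrefactor √x) atTop (nhds C))
    (hpos : ∀ x ∈ Ioi x₀, 0 < y x) :
    y₁ x₀ * airyExpansion (-5 / 48) (385 / 4608) (-1 / 6) √x₀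
        ≤ y x₀ * airyExpansionDeriv (-5 / 48) (385 / 4608) (-1 / 6) √x₀ ∧
      C * airyExpansion (-5 / 48) (385 / 4608) (-1 / 6) √x₀ ≤ y x₀ := by
  have hx3 : ∀ x ∈ Ici x₀, 3 ≤ x := fun x hx => hx₀.trans hx
  have hx0 : ∀ x ∈ Ici x₀, 0 < x := fun x hx => by linarith [hx3 x hx]
  have hF := fun x (hx : x ∈ Ici x₀) =>
    hasDerivAt_airyExpansion (hx0 x hx) (-5 / 48) (385 / 4608) (-1 / 6)
  have hF₁ := fun x (hx : x ∈ Ici x₀) =>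
    hasDerivAt_airyExpansionDeriv (hx0 x hx) (-5 / 48) (385 / 4608) (-1 / 6)
  have hL := fun x (hx : x ∈ Ici x₀) =>
    airyExpansion_bounds (hx3 x hx) (c := -1 / 6) (by norm_num) (by norm_num)
  refine sturm_comparison_atTop (M := 1) hyc hy₁c
    (fun x hx => (hF x hx).continuousAt.continuousWithinAt)
    (fun x hx => (hF₁ x hx).continuousAt.continuousWithinAt) hy hy₁
    (fun x hx => hF x (Ioi_subset_Ici_self hx)) (fun x hx => hF₁ x (Ioi_subset_Ici_self hx))
    (fun x hx => (hL x hx).1)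
    (fun x hx => (hL x hx).2.trans
      (airyPrefactor_le_one (one_le_sqrt.2 (by linarith [hx3 x hx]))))
    (fun x hx => ?_) (tendsto_div_airyExpansion hlim _ _ _)
  have hyx := hpos x hx
  have hx' : x ∈ Ici x₀ := Ioi_subset_Ici_self hx
  have hr : 0 < (√x)⁻¹ := inv_pos.2 (sqrt_pos.2 (hx0 x hx'))
  have hres : airyResidual (-5 / 48) (385 / 4608) (-1 / 6) √x ≤ 0 := by
    rw [airyResidual]
    linarith [pow_pos hr 10, pow_pos hr 13]
  have h1 : y x * (airyPrefactor √x * airyResidual (-5 / 48) (385 / 4608) (-1 / 6) √x) ≤ 0 :=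
    mul_nonpos_of_nonneg_of_nonpos hyx.le
      (mul_nonpos_of_nonneg_of_nonpos (airyPrefactor_pos _).le hres)
  have h2 : 0 ≤ 2 * y x ^ 3 * airyExpansion (-5 / 48) (385 / 4608) (-1 / 6) √x :=
    mul_nonneg (by positivity) (hL x hx').1.le
  linarith

lemma airyPrefactor_sq_le {s : ℝ} (hs : 0 < s) (hz : s⁻¹ ^ 3 ≤ 1 / 5) :
    airyPrefactor s ^ 2 ≤ 11 / 10 * s⁻¹ ^ 10 := by
  have hs3 : 5 ≤ s ^ 3 := by
    rw [inv_pow, one_div] at hz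
    exact (inv_le_inv₀ (by positivity) (by norm_num)).1 hz
  have he : 10 / 11 * s ^ 9 ≤ exp (4 / 3 * s ^ 3) := by
    have h := pow_div_factorial_le_exp (4 / 3 * s ^ 3) (by positivity) 6
    refine le_trans ?_ h
    norm_num [Nat.factorial]
    have : 5 ^ 3 * s ^ 9 ≤ (s ^ 3) ^ 3 * s ^ 9 := by gcongr
    nlinarith [pow_pos hs 9]
  rw [airyPrefactor_sq hs, neg_mul, exp_neg]
  calc (exp (4 / 3 * s ^ 3))⁻¹ / s ≤ (10 / 11 * s ^ 9)⁻¹ / s := by gcongr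
    _ = 11 / 10 * s⁻¹ ^ 10 := by field_simp

/-- A positive solution `y ∼ C x^(-1/4) exp (-(2/3) x^(3/2))` of `y'' = 2y³ + xy` that stays below
`2C` times an Airy supersolution stays below `C` times it, with a larger logarithmic derivative. -/
lemma painleveII_le_airyExpansion {y y₁ : ℝ → ℝ} {x₀ C : ℝ} (hx₀ : 3 ≤ x₀) (hC : 8 * C ^ 2 ≤ 1)
    (hyc : ContinuousOn y (Ici x₀)) (hy₁c : ContinuousOn y₁ (Ici x₀))
    (hy : ∀ x ∈ Ioi x₀, HasDerivAt y (y₁ x) x)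
    (hy₁ : ∀ x ∈ Ioi x₀, HasDerivAt y₁ (2 * y x ^ 3 + x * y x) x)
    (hlim : Tendsto (fun x => y x / airyPrefactor √x) atTop (nhds C))
    (hpos : ∀ x ∈ Ioi x₀, 0 < y x)
    (hlt : ∀ x ∈ Ioi x₀, y x < 2 * C * airyExpansion (-5 / 48) (385 / 4608) 0 √x) :
    y x₀ * airyExpansionDeriv (-5 / 48) (385 / 4608) 0 √x₀
        ≤ y₁ x₀ * airyExpansion (-5 / 48) (385 / 4608) 0 √x₀ ∧
      y x₀ ≤ C * airyExpansion (-5 / 48) (385 / 4608) 0 √x₀ := by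
  have hx3 : ∀ x ∈ Ici x₀, 3 ≤ x := fun x hx => hx₀.trans hx
  have hx0 : ∀ x ∈ Ici x₀, 0 < x := fun x hx => by linarith [hx3 x hx]
  have hF := fun x (hx : x ∈ Ici x₀) =>
    hasDerivAt_airyExpansion (hx0 x hx) (-5 / 48) (385 / 4608) 0
  have hF₁ := fun x (hx : x ∈ Ici x₀) =>
    hasDerivAt_airyExpansionDeriv (hx0 x hx) (-5 / 48) (385 / 4608) 0
  have hU := fun x (hx : x ∈ Ici x₀) =>
    airyExpansion_bounds (hx3 x hx) (c := 0) (by norm_num) (by norm_num)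
  have h := sturm_comparison_atTop (M := 1) (C := -C) (y := fun x => -y x)
    (y₁ := fun x => -y₁ x) (y₂ := fun x => -(2 * y x ^ 3 + x * y x)) hyc.neg hy₁c.neg
    (fun x hx => (hF x hx).continuousAt.continuousWithinAt)
    (fun x hx => (hF₁ x hx).continuousAt.continuousWithinAt)
    (fun x hx => (hy x hx).fun_neg) (fun x hx => (hy₁ x hx).fun_neg)
    (fun x hx => hF x (Ioi_subset_Ici_self hx)) (fun x hx => hF₁ x (Ioi_subset_Ici_self hx))
    (fun x hx => (hU x hx).1)
    (fun x hx => (hU x hx).2.trans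
      (airyPrefactor_le_one (one_le_sqrt.2 (by linarith [hx3 x hx]))))
    (fun x hx => ?_) (by simpa only [neg_div] using (tendsto_div_airyExpansion hlim _ _ _).neg)
  · constructor <;> linarith [h.1, h.2]
  · have hyx := hpos x hx
    have hx' : x ∈ Ici x₀ := Ioi_subset_Ici_self hx
    have hs : 0 < √x := sqrt_pos.2 (hx0 x hx')
    have hres : airyResidual (-5 / 48) (385 / 4608) 0 √x = 85085 / 73728 * (√x)⁻¹ ^ 10 := by
      rw [airyResidual]
      ring
    have hB := airyPrefactor_pos √x
    have hB2 := airyPrefactor_sq_le hs (sqrt_inv_cube_le (hx3 x hx'))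
    obtain ⟨hU0, hUB⟩ := hU x hx'
    have hy2 : 2 * y x ^ 2 ≤ airyPrefactor √x ^ 2 := by
      calc 2 * y x ^ 2
          ≤ 2 * (2 * C * airyExpansion (-5 / 48) (385 / 4608) 0 √x) ^ 2 := by
            gcongr
            exact (hlt x hx).le
        _ = 8 * C ^ 2 * airyExpansion (-5 / 48) (385 / 4608) 0 √x ^ 2 := by ring
        _ ≤ 1 * airyPrefactor √x ^ 2 := by gcongr
        _ = _ := one_mul _
    have hkey : 2 * y x ^ 2 * airyExpansion (-5 / 48) (385 / 4608) 0 √x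
        ≤ airyPrefactor √x * airyResidual (-5 / 48) (385 / 4608) 0 √x := by
      calc 2 * y x ^ 2 * airyExpansion (-5 / 48) (385 / 4608) 0 √x
          ≤ airyPrefactor √x ^ 2 * airyPrefactor √x := by gcongr
        _ ≤ (11 / 10 * (√x)⁻¹ ^ 10) * airyPrefactor √x := by gcongr
        _ ≤ (85085 / 73728 * (√x)⁻¹ ^ 10) * airyPrefactor √x := by
          gcongr ?_ * _ * _
          norm_num
        _ = _ := by rw [hres]; ring
    linarith [mul_le_mul_of_nonneg_left hkey hyx.le]

lemma airyPrefactor_sqrt_three_bounds :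
    67090 / 10 ^ 7 < (2 * √π)⁻¹ * airyPrefactor √3 ∧
      (2 * √π)⁻¹ * airyPrefactor √3 < 67099 / 10 ^ 7 := by
  set K := (2 * √π)⁻¹ * airyPrefactor √3 with hK
  have hs : 0 < √3 := by positivity
  have hs1 : 1.7320508 < √3 := lt_sqrt_of_sq_lt (by norm_num)
  have hs2 : √3 < 1.7320509 := (sqrt_lt' (by norm_num)).2 (by norm_num)
  have hK0 : 0 < K := mul_pos (by positivity) (airyPrefactor_pos _)
  have hs3 : √3 ^ 3 = 3 * √3 := by rw [pow_succ, sq_sqrt (by norm_num)]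
  have hK2 : K ^ 2 * (4 * π * √3 * exp 1 ^ 7) = exp (7 - 4 * √3) := by
    rw [hK, mul_pow, airyPrefactor_sq hs, hs3, inv_pow, mul_pow, sq_sqrt pi_pos.le,
      ← exp_nat_mul, show 7 - 4 * √3 = -(4 / 3) * (3 * √3) + ((7 : ℕ) : ℝ) * 1 by push_cast; ring,
      exp_add]
    field_simp
    norm_num
  have hlow : 1.07436 < exp (7 - 4 * √3) := by
    have := quadratic_le_exp_of_nonneg (x := 7 - 4 * √3) (by linarith)
    nlinarith
  have hup : exp (7 - 4 * √3) < 1.0745 := by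
    refine (exp_le_exp.2 (show 7 - 4 * √3 ≤ 0.0718 by linarith)).trans_lt ?_
    refine (exp_bound' (by norm_num) (by norm_num) (n := 4) (by norm_num)).trans_lt ?_
    norm_num [Finset.sum_range_succ, Nat.factorial]
  have he1 : (2.718281 : ℝ) ^ 7 < exp 1 ^ 7 := by
    gcongr
    linarith [exp_one_gt_d9]
  have he2 : exp 1 ^ 7 < (2.718282 : ℝ) ^ 7 := by
    gcongr
    linarith [exp_one_lt_d9]
  constructor
  · by_contra! h
    have : K ^ 2 * (4 * π * √3 * exp 1 ^ 7) ≤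
        (67090 / 10 ^ 7) ^ 2 * (4 * 3.141593 * 1.7320509 * 2.718282 ^ 7) := by
      gcongr
      exact pi_lt_d6.le
    rw [hK2] at this
    norm_num at this hlow
    linarith
  · by_contra! h
    have : (67099 / 10 ^ 7) ^ 2 * (4 * 3.141592 * 1.7320508 * 2.718281 ^ 7) ≤
        K ^ 2 * (4 * π * √3 * exp 1 ^ 7) := by
      gcongr
      exact pi_gt_d6.le
    rw [hK2] at this
    norm_num at this hup
    linarith

/-- Values of the Hastings–McLeod solution at `x = 3`: if `y` is a twice continuously
differentiable solution of `y'' = 2y³ + xy` on `[3, ∞)` with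
`2√π x^{1/4} e^{(2/3)x^{3/2}} y(x) → 1` as `x → +∞`, then `|y(3) − 4/607| < 8·10⁻⁶` and
`|y'(3) + 64/5375| < 24·10⁻⁶`. -/
theorem hastingsMcLeod_value_at_three (y : ℝ → ℝ)
    (hreg : ContDiffOn ℝ 2 y (Ici 3))
    (heq : ∀ x ∈ Ici (3 : ℝ),
      derivWithin (derivWithin y (Ici 3)) (Ici 3) x = 2 * y x ^ 3 + x * y x)
    (hasymp : Tendsto (fun x : ℝ =>
        2 * Real.sqrt π * x ^ ((1 : ℝ)/4) * Real.exp ((2/3) * x ^ ((3 : ℝ)/2)) * y x)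
      atTop (nhds 1)) :
    |y 3 - 4/607| < 8 / 10 ^ 6 ∧ |derivWithin y (Ici 3) 3 + 64/5375| < 24 / 10 ^ 6 := by
  have hreg₁ : ContDiffOn ℝ 1 (derivWithin y (Ici 3)) (Ici 3) :=
    hreg.derivWithin (uniqueDiffOn_Ici 3) (by norm_num)
  have hyc := hreg.continuousOn
  have hy₁c := hreg₁.continuousOn
  have hy : ∀ x ∈ Ioi (3 : ℝ), HasDerivAt y (derivWithin y (Ici 3) x) x := fun x hx =>
    ((hreg.differentiableOn (by norm_num)) x (Ioi_subset_Ici_self hx)).hasDerivWithinAt.hasDerivAt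
      (Ici_mem_nhds hx)
  have hy₁ : ∀ x ∈ Ioi (3 : ℝ),
      HasDerivAt (derivWithin y (Ici 3)) (2 * y x ^ 3 + x * y x) x := fun x hx => by
    rw [← heq x (Ioi_subset_Ici_self hx)]
    exact ((hreg₁.differentiableOn (by norm_num)) x
      (Ioi_subset_Ici_self hx)).hasDerivWithinAt.hasDerivAt (Ici_mem_nhds hx)
  clear heq hreg hreg₁
  generalize derivWithin y (Ici 3) = y₁ at *
  obtain ⟨hK₁, hK₂⟩ := airyPrefactor_sqrt_three_bounds
  have hC0 : 0 < (2 * √π)⁻¹ := by positivity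
  have hC8 : 8 * (2 * √π)⁻¹ ^ 2 ≤ 1 := by
    rw [inv_pow, mul_pow, sq_sqrt pi_pos.le, ← div_eq_mul_inv, div_le_one (by positivity)]
    linarith [pi_gt_three]
  have hlim : Tendsto (fun x => y x / airyPrefactor √x) atTop (nhds (2 * √π)⁻¹) := by
    have h := hasymp.const_mul (2 * √π)⁻¹
    rw [mul_one] at h
    refine h.congr' ?_
    filter_upwards [eventually_gt_atTop 0] with x hx
    rw [div_eq_mul_inv (y x), inv_airyPrefactor_sqrt hx]
    have : 0 < √π := by positivity
    field_simp
  clear hasymp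
  generalize (2 * √π)⁻¹ = C at *
  have hpos : ∀ x ∈ Ici (3 : ℝ), 0 < y x := by
    refine pos_of_backward_induction hyc ?_ fun x (hx : 3 ≤ x) hz => ?_
    · filter_upwards [hlim.eventually_const_lt hC0] with x hx
      exact (div_pos_iff_of_pos_right (airyPrefactor_pos _)).1 hx
    · have hsub := Ioi_subset_Ioi hx
      exact lt_of_lt_of_le
        (mul_pos hC0 (airyExpansion_bounds hx (c := -1 / 6) (by norm_num) (by norm_num)).1)
        (airyExpansion_le_painleveII hx (hyc.mono (Ici_subset_Ici.2 hx))
          (hy₁c.mono (Ici_subset_Ici.2 hx)) (fun w hw => hy w (hsub hw))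
          (fun w hw => hy₁ w (hsub hw)) hlim hz).2
  have hlt : ∀ x ∈ Ici (3 : ℝ),
      0 < 2 * C * airyExpansion (-5 / 48) (385 / 4608) 0 √x - y x := by
    refine pos_of_backward_induction ?_ ?_ fun x (hx : 3 ≤ x) hz => ?_
    · refine ContinuousOn.sub (fun x (hx : 3 ≤ x) => ?_) hyc
      exact ((hasDerivAt_airyExpansion (by linarith) _ _ _).continuousAt.const_mul
        _).continuousWithinAt
    · filter_upwards [eventually_ge_atTop 3,
        (tendsto_div_airyExpansion hlim (-5 / 48) (385 / 4608) 0).eventually_lt_const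
          (show C < 2 * C by linarith)] with x hx3 hx
      rw [div_lt_iff₀ (airyExpansion_bounds hx3 (by norm_num) le_rfl).1] at hx
      linarith
    · have hsub := Ioi_subset_Ioi hx
      have h := (painleveII_le_airyExpansion hx hC8 (hyc.mono (Ici_subset_Ici.2 hx))
        (hy₁c.mono (Ici_subset_Ici.2 hx)) (fun w hw => hy w (hsub hw))
        (fun w hw => hy₁ w (hsub hw)) hlim
        (fun w hw => hpos w (Ioi_subset_Ici_self (hsub hw)))
        (fun w hw => sub_pos.1 (hz w hw))).2
      linarith [hpos x hx]
  obtain ⟨hl₁, hl₂⟩ := airyExpansion_le_painleveII le_rfl hyc hy₁c hy hy₁ hlim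
    fun x hx => hpos x (Ioi_subset_Ici_self hx)
  obtain ⟨hu₁, hu₂⟩ := painleveII_le_airyExpansion le_rfl hC8 hyc hy₁c hy hy₁ hlim
    (fun x hx => hpos x (Ioi_subset_Ici_self hx))
    fun x hx => sub_pos.1 (hlt x (Ioi_subset_Ici_self hx))
  have hr1 : 0.57735 < (√3)⁻¹ := by
    rw [lt_inv_comm₀ (by norm_num) (by positivity)]
    exact (sqrt_lt' (by norm_num)).2 (by norm_num)
  have hr2 : (√3)⁻¹ < 0.577351 := by
    rw [inv_lt_comm₀ (by positivity) (by norm_num)]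
    exact lt_sqrt_of_sq_lt (by norm_num)
  have hr3 : √3 = 3 * (√3)⁻¹ := by
    rw [← div_eq_mul_inv, div_sqrt]
  have hr3' : (√3)⁻¹ ^ 2 = 1 / 3 := by
    rw [inv_pow, sq_sqrt (by norm_num), one_div]
  have hodd : ∀ n : ℕ, (√3)⁻¹ ^ (2 * n + 1) = (1 / 3) ^ n * (√3)⁻¹ := fun n => by
    rw [pow_succ, pow_mul, hr3']
  have heven : ∀ n : ℕ, (√3)⁻¹ ^ (2 * n) = (1 / 3) ^ n := fun n => by rw [pow_mul, hr3']
  have hpow₃ := hodd 1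
  have hpow₅ := hodd 2
  have hpow₉ := hodd 4
  have hpow₁₁ := hodd 5
  have hpow₆ := heven 3
  have hpow₈ := heven 4
  norm_num only at hr3' hpow₃ hpow₅ hpow₆ hpow₈ hpow₉ hpow₁₁
  have hB := airyPrefactor_pos √3
  obtain ⟨p, hp, hp1⟩ : ∃ p, airyExpansion (-5 / 48) (385 / 4608) (-1 / 6) √3 =
      airyPrefactor √3 * p ∧ 0.9811 < p := ⟨_, rfl, by linarith⟩
  obtain ⟨p', hp', hp'1, hp'2⟩ : ∃ p, airyExpansion (-5 / 48) (385 / 4608) 0 √3 =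
      airyPrefactor √3 * p ∧ 0.983 < p ∧ p < 0.9832 := ⟨_, rfl, by linarith, by linarith⟩
  obtain ⟨q, hq, hq1⟩ : ∃ q, airyExpansionDeriv (-5 / 48) (385 / 4608) (-1 / 6) √3 =
      airyPrefactor √3 * q ∧ q < -1.772 := ⟨_, rfl, by linarith⟩
  obtain ⟨q', hq', hq'1, hq'2⟩ : ∃ q, airyExpansionDeriv (-5 / 48) (385 / 4608) 0 √3 =
      airyPrefactor √3 * q ∧ -1.778 < q ∧ q < 0 := ⟨_, rfl, by linarith, by linarith⟩
  rw [hp, hq, mul_left_comm, mul_left_comm (y 3), mul_le_mul_iff_right₀ hB] at hl₁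
  rw [hp', hq', mul_left_comm, mul_left_comm (y₁ 3), mul_le_mul_iff_right₀ hB] at hu₁
  rw [hp, ← mul_assoc] at hl₂
  rw [hp', ← mul_assoc] at hu₂
  generalize C * airyPrefactor √3 = K at *
  have hK : 0 < K := by linarith
  have hy₁le : y₁ 3 ≤ K * q := by
    refine le_of_mul_le_mul_right (a := p) ?_ (by linarith)
    linarith [mul_le_mul_of_nonpos_right hl₂ (show q ≤ 0 by linarith)]
  have hley₁ : K * q' ≤ y₁ 3 := by
    refine le_of_mul_le_mul_right (a := p') ?_ (by linarith)
    linarith [mul_le_mul_of_nonpos_right hu₂ hq'2.le]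
  have h1 : K * 0.9811 ≤ K * p := by gcongr
  have h2 : K * p' ≤ K * 0.9832 := by gcongr
  have h3 : K * -1.778 ≤ K * q' := by gcongr
  have h4 : K * q ≤ K * -1.772 := by gcongr
  rw [abs_lt, abs_lt]
  norm_num at hK₁ hK₂ h1 h2 h3 h4 ⊢
  refine ⟨⟨?_, ?_⟩, ?_, ?_⟩ <;> linarith
end

section
/- Let y : [0, 3] → ℝ be twice continuously differentiable with y''(x) = 2y(x)³ + x·y(x) for all x ∈ [0, 3], and suppose |y(3) − 4/607| < 8·10⁻⁶ and |y'(3) + 64/5375| < 24·10⁻⁶. Then |y(0) − 98/267| < 11·10⁻⁴ and |y'(0) + 153/518| < 12·10⁻⁴. -/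
open Set

/-- If `w'' ≥ 0` on `(a, b)` and `w' b < 0`, then going back from `b` to `a` keeps `w' < 0` and
increases `w`. -/
theorem neg_deriv_and_le_of_nonneg_deriv2 {w w₁ w₂ : ℝ → ℝ} {a b : ℝ} (hab : a ≤ b)
    (hw : ∀ x ∈ Icc a b, HasDerivWithinAt w (w₁ x) (Icc a b) x)
    (hw₁ : ∀ x ∈ Icc a b, HasDerivWithinAt w₁ (w₂ x) (Icc a b) x)
    (hb : w₁ b < 0) (hconv : ∀ x ∈ Ioo a b, 0 ≤ w₂ x) :
    w₁ a < 0 ∧ w b ≤ w a := by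
  have hmono : MonotoneOn w₁ (Icc a b) :=
    monotoneOn_of_hasDerivWithinAt_nonneg (convex_Icc a b)
      (fun x hx => (hw₁ x hx).continuousWithinAt)
      (fun x hx => (hw₁ x (interior_subset hx)).mono interior_subset)
      (fun x hx => hconv x (by rwa [interior_Icc] at hx))
  have hneg : ∀ x ∈ Icc a b, w₁ x < 0 := fun x hx =>
    (hmono hx (right_mem_Icc.2 hab) hx.2).trans_lt hb
  have hanti : AntitoneOn w (Icc a b) :=
    antitoneOn_of_hasDerivWithinAt_nonpos (convex_Icc a b)
      (fun x hx => (hw x hx).continuousWithinAt)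
      (fun x hx => (hw x (interior_subset hx)).mono interior_subset)
      (fun x hx => (hneg x (interior_subset hx)).le)
  exact ⟨hneg a (left_mem_Icc.2 hab), hanti (left_mem_Icc.2 hab) (right_mem_Icc.2 hab) hab⟩

/-- Backward positivity: if `w b > 0`, `w' b < 0` and `w'' ≥ 0` wherever `w > 0`, then
`w a > 0` and `w' a < 0`. -/
theorem pos_and_neg_deriv_of_backward {w w₁ w₂ : ℝ → ℝ} {a b : ℝ} (hab : a ≤ b)
    (hw : ∀ x ∈ Icc a b, HasDerivWithinAt w (w₁ x) (Icc a b) x)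
    (hw₁ : ∀ x ∈ Icc a b, HasDerivWithinAt w₁ (w₂ x) (Icc a b) x)
    (hb : 0 < w b) (hb₁ : w₁ b < 0) (hconv : ∀ x ∈ Icc a b, 0 < w x → 0 ≤ w₂ x) :
    0 < w a ∧ w₁ a < 0 := by
  have key : ∀ c ∈ Icc a b, (∀ x ∈ Ioo c b, 0 < w x) → w₁ c < 0 ∧ w b ≤ w c := by
    intro c hc hpos
    have hsub : Icc c b ⊆ Icc a b := Icc_subset_Icc_left hc.1
    exact neg_deriv_and_le_of_nonneg_deriv2 hc.2 (fun x hx => (hw x (hsub hx)).mono hsub)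
      (fun x hx => (hw₁ x (hsub hx)).mono hsub) hb₁
      (fun x hx => hconv x (hsub (Ioo_subset_Icc_self hx)) (hpos x hx))
  have hpos : ∀ x ∈ Icc a b, 0 < w x := by
    by_contra! hne
    have hcont : ContinuousOn w (Icc a b) := fun x hx => (hw x hx).continuousWithinAt
    have hcpt : IsCompact (Icc a b ∩ w ⁻¹' Iic 0) :=
      isCompact_Icc.of_isClosed_subset
        (hcont.preimage_isClosed_of_isClosed isClosed_Icc isClosed_Iic) inter_subset_left
    obtain ⟨c, ⟨hc, hwc⟩, hmax⟩ := hcpt.exists_isGreatest hne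
    refine absurd (hb.trans_le (key c hc fun x hx => ?_).2) (not_lt.2 hwc)
    by_contra! hx0
    exact absurd (hmax ⟨⟨hc.1.trans hx.1.le, hx.2.le⟩, hx0⟩) (not_le.2 hx.1)
  have ha := left_mem_Icc.2 hab
  exact ⟨hpos a ha, (key a ha fun x hx => hpos x (Ioo_subset_Icc_self hx)).1⟩

open Polynomial in
/-- A polynomial supersolution of Painlevé II bounds a solution backward in `x`. -/
theorem painleveII_lt_supersolution {y y₁ : ℝ → ℝ} {b : ℝ} (hb : 0 ≤ b) (U : ℝ[X])
    (hy : ∀ x ∈ Icc 0 b, HasDerivWithinAt y (y₁ x) (Icc 0 b) x)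
    (hy₁ : ∀ x ∈ Icc 0 b, HasDerivWithinAt y₁ (2 * y x ^ 3 + x * y x) (Icc 0 b) x)
    (hU : ∀ x ∈ Icc 0 b,
      2 * U.eval x ^ 3 + x * U.eval x ≤ (derivative (derivative U)).eval x)
    (hval : y b < U.eval b) (hder : (derivative U).eval b < y₁ b) :
    y 0 < U.eval 0 ∧ (derivative U).eval 0 < y₁ 0 := by
  have h := pos_and_neg_deriv_of_backward hb
    (w := fun x => U.eval x - y x) (w₁ := fun x => (derivative U).eval x - y₁ x)
    (fun x hx => (U.hasDerivAt x).hasDerivWithinAt.sub (hy x hx))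
    (fun x hx => ((derivative U).hasDerivAt x).hasDerivWithinAt.sub (hy₁ x hx))
    (sub_pos.2 hval) (sub_neg.2 hder) fun x hx hlt => by
      have hlt := sub_pos.1 hlt
      have hcube : y x ^ 3 ≤ U.eval x ^ 3 := (Odd.strictMono_pow (by decide : Odd 3) hlt).le
      have hlin := mul_le_mul_of_nonneg_left hlt.le hx.1
      linarith [hU x hx]
  exact ⟨sub_pos.1 h.1, sub_neg.1 h.2⟩

open Polynomial in
/-- A polynomial supersolution of Painlevé II on `[0, 3]` dominating the data at `3`. -/
noncomputable def hastingsMcLeodUpper : ℝ[X] :=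
  C (367736393 / 10 ^ 9) +
    C (-2960336830 / 10 ^ 10) * X +
    C (497416756 / 10 ^ 10) * X ^ 2 +
    C (2126790975 / 10 ^ 11) * X ^ 3 +
    C (-526365171 / 10 ^ 11) * X ^ 4 +
    C (-2287063842 / 10 ^ 12) * X ^ 5 +
    C (341783907 / 10 ^ 12) * X ^ 6 +
    C (6459968603 / 10 ^ 13) * X ^ 7 +
    C (-3564506588 / 10 ^ 13) * X ^ 8 +
    C (8594321787 / 10 ^ 14) * X ^ 9 +
    C (-1056475732 / 10 ^ 14) * X ^ 10 +
    C (542495608 / 10 ^ 15) * X ^ 11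

open Polynomial in
/-- The negative of a polynomial subsolution of Painlevé II on `[0, 3]`. -/
noncomputable def hastingsMcLeodNegLower : ℝ[X] :=
  C (-366098261 / 10 ^ 9) +
    C (2944370902 / 10 ^ 10) * X +
    C (-490537168 / 10 ^ 10) * X ^ 2 +
    C (-2156598763 / 10 ^ 11) * X ^ 3 +
    C (544920746 / 10 ^ 11) * X ^ 4 +
    C (2203405709 / 10 ^ 12) * X ^ 5 +
    C (-323947300 / 10 ^ 12) * X ^ 6 +
    C (-6449738580 / 10 ^ 13) * X ^ 7 +
    C (3548359172 / 10 ^ 13) * X ^ 8 +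
    C (-8552647093 / 10 ^ 14) * X ^ 9 +
    C (1051464943 / 10 ^ 14) * X ^ 10 +
    C (-540048217 / 10 ^ 15) * X ^ 11

open Polynomial in
/-- Substituting `x = 3u / (1 + u)` turns the inequality into positivity of coefficients. -/
theorem hastingsMcLeodUpper_supersolution {x : ℝ} (hx : x ∈ Icc (0 : ℝ) 3) :
    2 * hastingsMcLeodUpper.eval x ^ 3 + x * hastingsMcLeodUpper.eval x ≤
      (derivative (derivative hastingsMcLeodUpper)).eval x := by
  simp [hastingsMcLeodUpper]
  obtain ⟨h0, h3⟩ := hx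
  rcases h3.eq_or_lt with rfl | h3
  · norm_num
  obtain ⟨u, hu, rfl⟩ : ∃ u : ℝ, 0 ≤ u ∧ x = 3 * u / (1 + u) := by
    refine ⟨x / (3 - x), div_nonneg h0 (sub_pos.2 h3).le, ?_⟩
    have := (sub_pos.2 h3).ne'
    field_simp
    ring
  rw [← sub_nonneg]
  field_simp
  ring_nf
  positivity

open Polynomial in
/-- Substituting `x = 3u / (1 + u)` turns the inequality into positivity of coefficients. -/
theorem hastingsMcLeodNegLower_supersolution {x : ℝ} (hx : x ∈ Icc (0 : ℝ) 3) :
    2 * hastingsMcLeodNegLower.eval x ^ 3 + x * hastingsMcLeodNegLower.eval x ≤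
      (derivative (derivative hastingsMcLeodNegLower)).eval x := by
  simp [hastingsMcLeodNegLower]
  obtain ⟨h0, h3⟩ := hx
  rcases h3.eq_or_lt with rfl | h3
  · norm_num
  obtain ⟨u, hu, rfl⟩ : ∃ u : ℝ, 0 ≤ u ∧ x = 3 * u / (1 + u) := by
    refine ⟨x / (3 - x), div_nonneg h0 (sub_pos.2 h3).le, ?_⟩
    have := (sub_pos.2 h3).ne'
    field_simp
    ring
  rw [← sub_nonneg]
  field_simp
  ring_nf
  positivity

/-- Backward propagation of estimates for Painlevé II on `[0, 3]`: if `y'' = 2y³ + xy` on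
`[0, 3]` with `|y(3) − 4/607| < 8·10⁻⁶` and `|y'(3) + 64/5375| < 24·10⁻⁶`, then
`|y(0) − 98/267| < 11·10⁻⁴` and `|y'(0) + 153/518| < 12·10⁻⁴`. -/
theorem hastingsMcLeod_value_at_zero (y : ℝ → ℝ)
    (hreg : ContDiffOn ℝ 2 y (Icc 0 3))
    (heq : ∀ x ∈ Icc (0 : ℝ) 3,
      derivWithin (derivWithin y (Icc 0 3)) (Icc 0 3) x = 2 * y x ^ 3 + x * y x)
    (hval : |y 3 - 4/607| < 8 / 10 ^ 6)
    (hder : |derivWithin y (Icc 0 3) 3 + 64/5375| < 24 / 10 ^ 6) :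
    |y 0 - 98/267| < 11 / 10 ^ 4 ∧ |derivWithin y (Icc 0 3) 0 + 153/518| < 12 / 10 ^ 4 := by
  have huniq : UniqueDiffOn ℝ (Icc (0 : ℝ) 3) := uniqueDiffOn_Icc (by norm_num)
  have hy : ∀ x ∈ Icc (0 : ℝ) 3,
      HasDerivWithinAt y (derivWithin y (Icc 0 3) x) (Icc 0 3) x := fun x hx =>
    (hreg.differentiableOn (by norm_num) x hx).hasDerivWithinAt
  have hy₁ : ∀ x ∈ Icc (0 : ℝ) 3,
      HasDerivWithinAt (derivWithin y (Icc 0 3)) (2 * y x ^ 3 + x * y x) (Icc 0 3) x :=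
    fun x hx => heq x hx ▸
      ((hreg.derivWithin huniq (m := 1) (by norm_num)).differentiableOn
        (by norm_num) x hx).hasDerivWithinAt
  rw [abs_lt] at hval hder
  have hupper := painleveII_lt_supersolution (by norm_num) hastingsMcLeodUpper hy hy₁
    (fun x hx => hastingsMcLeodUpper_supersolution hx)
    (by norm_num [hastingsMcLeodUpper]; linarith)
    (by norm_num [hastingsMcLeodUpper]; linarith)
  have hlower := painleveII_lt_supersolution (by norm_num) hastingsMcLeodNegLower
    (fun x hx => (hy x hx).neg)
    (fun x hx => ((hy₁ x hx).neg).congr_deriv (by simp only [Pi.neg_apply]; ring))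
    (fun x hx => hastingsMcLeodNegLower_supersolution hx)
    (by norm_num [hastingsMcLeodNegLower]; linarith)
    (by norm_num [hastingsMcLeodNegLower]; linarith)
  norm_num [hastingsMcLeodUpper] at hupper
  norm_num [hastingsMcLeodNegLower] at hlower
  simp only [abs_lt]
  refine ⟨⟨?_, ?_⟩, ?_, ?_⟩ <;> linarith
end

section
/- Let y₂ be the polynomial y₂(r) = 400t¹⁰/11977 + 265t⁹/11857 − 855t⁸/10951 − 149t⁷/6608 + 293t⁶/2551 + 1013t⁵/14669 + 128t⁴/6441 + 424t³/6079 + 1261t²/13159 + 549t/7508 + 267/9871 with t = r − 1. Then y₂(0) > 11·10⁻⁴, y₂'(0) > 12·10⁻⁴, and for all r ∈ [0, 9/4]: y₂(r) > 0, y₂(r) < 6/5, and y₂''(r) > (12/5)(r + 1)·y₂(r) + 8·y₂(r)² + 2·y₂(r)³ + 3/500. -/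
open Set

/-- The degree-10 polynomial supersolution `y₂`, in the variable `t = r − 1`. -/
noncomputable def y2 (r : ℝ) : ℝ :=
  400 * (r - 1) ^ 10 / 11977 + 265 * (r - 1) ^ 9 / 11857 - 855 * (r - 1) ^ 8 / 10951
    - 149 * (r - 1) ^ 7 / 6608 + 293 * (r - 1) ^ 6 / 2551 + 1013 * (r - 1) ^ 5 / 14669
    + 128 * (r - 1) ^ 4 / 6441 + 424 * (r - 1) ^ 3 / 6079 + 1261 * (r - 1) ^ 2 / 13159
    + 549 * (r - 1) / 7508 + 267 / 9871

namespace RatPoly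

/-- Evaluation at a real point of the polynomial with the given coefficients, constant term
first. -/
def eval : List ℚ → ℝ → ℝ
  | [], _ => 0
  | c :: p, t => c + t * eval p t

/-- Sum of coefficient lists. -/
def add : List ℚ → List ℚ → List ℚ
  | [], q => q
  | p, [] => p
  | a :: p, b :: q => (a + b) :: add p q

/-- Scalar multiple of a coefficient list. -/
def smul (a : ℚ) : List ℚ → List ℚ
  | [] => []
  | c :: p => (a * c) :: smul a p

/-- Product of coefficient lists. -/
def mul : List ℚ → List ℚ → List ℚ
  | [], _ => []
  | a :: p, q => add (smul a q) (0 :: mul p q)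

/-- Formal derivative of a coefficient list. -/
def derivative : List ℚ → List ℚ
  | [] => []
  | _ :: p => add p (0 :: derivative p)

/-- Coefficients of `p (X + a)`. -/
def shift (a : ℚ) : List ℚ → List ℚ
  | [] => []
  | c :: p => add (c :: shift a p) (smul a (shift a p))

/-- An upper bound for `|p|` on `[-h, h]`. -/
def absBound (h : ℚ) : List ℚ → ℚ
  | [] => 0
  | c :: p => |c| + h * absBound h p

/-- A lower bound for `p` on `[-h, h]`. -/
def lowerBound (h : ℚ) : List ℚ → ℚ
  | [] => 0
  | c :: p => c - h * absBound h p

/-- A test for positivity of `p` on `[m - h, m + h]`, based on Taylor expansion at the centre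
after at most `n` bisections. -/
def posTest : ℕ → List ℚ → ℚ → ℚ → Bool
  | 0, p, m, h => decide (0 < lowerBound h (shift m p))
  | n + 1, p, m, h => decide (0 < lowerBound h (shift m p)) ||
      (posTest n p (m - h / 2) (h / 2) && posTest n p (m + h / 2) (h / 2))

theorem eval_add (p q : List ℚ) (t : ℝ) : eval (add p q) t = eval p t + eval q t := by
  induction p generalizing q with
  | nil => simp [add, eval]
  | cons a p ih =>
    cases q with
    | nil => simp [add, eval]
    | cons b q => simp only [add, eval, ih]; push_cast; ring

theorem eval_smul (a : ℚ) (p : List ℚ) (t : ℝ) : eval (smul a p) t = a * eval p t := by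
  induction p with
  | nil => simp [smul, eval]
  | cons c p ih => simp only [smul, eval, ih]; push_cast; ring

theorem eval_mul (p q : List ℚ) (t : ℝ) : eval (mul p q) t = eval p t * eval q t := by
  induction p with
  | nil => simp [mul, eval]
  | cons c p ih => simp only [mul, eval, eval_add, eval_smul, ih]; push_cast; ring

theorem eval_shift (a : ℚ) (p : List ℚ) (t : ℝ) : eval (shift a p) t = eval p (t + a) := by
  induction p with
  | nil => simp [shift, eval]
  | cons c p ih => simp only [shift, eval, eval_add, eval_smul, ih]; ring

theorem hasDerivAt_eval (p : List ℚ) (t : ℝ) :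
    HasDerivAt (eval p) (eval (derivative p) t) t := by
  induction p with
  | nil => exact hasDerivAt_const t (0 : ℝ)
  | cons c p ih =>
    have h := ((hasDerivAt_id t).mul ih).const_add (c : ℝ)
    refine h.congr_deriv ?_
    simp [derivative, eval, eval_add]

theorem abs_eval_le_absBound {h : ℚ} (p : List ℚ) {t : ℝ} (ht : |t| ≤ h) :
    |eval p t| ≤ absBound h p := by
  induction p with
  | nil => simp [eval, absBound]
  | cons c p ih =>
    simp only [eval, absBound]
    push_cast
    refine (abs_add_le _ _).trans ?_
    rw [abs_mul]
    have := mul_le_mul ht ih (abs_nonneg _) ((abs_nonneg t).trans ht)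
    linarith

theorem lowerBound_le_eval {h : ℚ} (p : List ℚ) {t : ℝ} (ht : |t| ≤ h) :
    lowerBound h p ≤ eval p t := by
  cases p with
  | nil => simp [eval, lowerBound]
  | cons c p =>
    simp only [eval, lowerBound]
    push_cast
    have hle := mul_le_mul ht (abs_eval_le_absBound p ht) (abs_nonneg _)
      ((abs_nonneg t).trans ht)
    rw [← abs_mul] at hle
    linarith [neg_abs_le (t * eval p t)]

theorem eval_pos_of_lowerBound_pos {p : List ℚ} {m h : ℚ} (hp : 0 < lowerBound h (shift m p))
    {t : ℝ} (ht : |t - m| ≤ h) : 0 < eval p t := by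
  have hle := lowerBound_le_eval (shift m p) ht
  rw [eval_shift, sub_add_cancel] at hle
  exact lt_of_lt_of_le (by exact_mod_cast hp) hle

theorem eval_pos_of_posTest {n : ℕ} {p : List ℚ} {m h : ℚ} (hp : posTest n p m h = true)
    {t : ℝ} (ht : |t - m| ≤ h) : 0 < eval p t := by
  induction n generalizing m h with
  | zero => exact eval_pos_of_lowerBound_pos (of_decide_eq_true hp) ht
  | succ n ih =>
    simp only [posTest, Bool.or_eq_true, Bool.and_eq_true, decide_eq_true_eq] at hp
    rcases hp with hp | hp
    · exact eval_pos_of_lowerBound_pos hp ht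
    obtain ⟨hl, hr⟩ := abs_le.1 ht
    rcases le_total t m with htm | htm
    · refine ih hp.1 (abs_le.2 ?_)
      push_cast
      constructor <;> linarith
    · refine ih hp.2 (abs_le.2 ?_)
      push_cast
      constructor <;> linarith

end RatPoly

open RatPoly

/-- The coefficients of `y2` in powers of `r - 1`. -/
def y2Coeffs : List ℚ :=
  [267 / 9871, 549 / 7508, 1261 / 13159, 424 / 6079, 128 / 6441, 1013 / 14669, 293 / 2551,
    -149 / 6608, -855 / 10951, 265 / 11857, 400 / 11977]

/-- The coefficients, in powers of `r - 1`, of the defect of `y2` in the differential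
inequality. -/
def y2Defect : List ℚ :=
  add (derivative (derivative y2Coeffs)) (smul (-1)
    (add [3 / 500] (mul y2Coeffs
      (add [24 / 5, 12 / 5] (mul y2Coeffs (add [8] (smul 2 y2Coeffs)))))))

theorem y2_eq_eval : y2 = fun r => eval y2Coeffs (r - 1) := by
  funext r
  simp only [y2, y2Coeffs, eval]
  push_cast
  ring

theorem deriv_eval_sub_one (p : List ℚ) :
    deriv (fun r => eval p (r - 1)) = fun r => eval (derivative p) (r - 1) := by
  funext r
  exact ((hasDerivAt_eval p (r - 1)).comp_sub_const r 1).deriv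

/-- Properties of the supersolution `y₂`: `y₂(0) > 11·10⁻⁴`, `y₂'(0) > 12·10⁻⁴`, and for all
`r ∈ [0, 9/4]`, `y₂ > 0`, `y₂ < 6/5`, and
`y₂'' > (12/5)(r+1)y₂ + 8y₂² + 2y₂³ + 3/500`. -/
theorem y2_supersolution :
    y2 0 > 11 / 10 ^ 4 ∧ deriv y2 0 > 12 / 10 ^ 4 ∧
    ∀ r ∈ Icc (0 : ℝ) (9/4),
      y2 r > 0 ∧ y2 r < 6/5 ∧
      deriv (deriv y2) r > 12/5 * (r + 1) * y2 r + 8 * y2 r ^ 2 + 2 * y2 r ^ 3 + 3/500 := by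
  have habs : ∀ r ∈ Icc (0 : ℝ) (9/4), |r - 1 - (1 / 8 : ℚ)| ≤ (9 / 8 : ℚ) := by
    intro r hr
    rw [abs_le]
    push_cast
    constructor <;> linarith [hr.1, hr.2]
  have hd : deriv y2 = fun r => eval (derivative y2Coeffs) (r - 1) := by
    rw [y2_eq_eval, deriv_eval_sub_one]
  refine ⟨by norm_num [y2], ?_, fun r hr => ⟨?_, ?_, ?_⟩⟩
  · rw [hd]
    norm_num [y2Coeffs, derivative, add, eval]
  · rw [y2_eq_eval]
    have htest : posTest 3 y2Coeffs (1 / 8) (9 / 8) = true := by decide +kernel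
    exact eval_pos_of_posTest htest (habs r hr)
  · have htest : posTest 1 (add [6 / 5] (smul (-1) y2Coeffs)) (1 / 8) (9 / 8) = true := by
      decide +kernel
    have h := eval_pos_of_posTest htest (habs r hr)
    simp only [eval_add, eval_smul, eval] at h
    push_cast at h
    rw [y2_eq_eval]
    linarith
  · have htest : posTest 6 y2Defect (1 / 8) (9 / 8) = true := by decide +kernel
    have h := eval_pos_of_posTest htest (habs r hr)
    simp only [y2Defect, eval_add, eval_smul, eval_mul, eval] at h
    push_cast at h
    rw [hd, deriv_eval_sub_one, y2_eq_eval]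
    linear_combination h
end
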